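/- arXiv:2409.09561 — 8 statements merged into one kernel-verified Lean document; each statement's English description precedes it below -/
import Mathlib

section
/- Non-unitarity of the hypergeometric amplitude (Theorem 1). Let a ∈ {0,1}, let D ≥ 4 be real, and let r, μ be real numbers such that either r > -1 or r is not an integer. If 2r + μ + a < 0, or if r < -1 and ⌊r⌋ is even, then there exist integers n ≥ 1 with n ≥ 3μ and 0 ≤ j ≤ n-1+a such that B^a_{n,j}(r,μ,D) < 0. -/
open MeasureTheory

/-- Rising factorial `(y)_(k) = y (y+1) ⋯ (y+k-1)`. -/
noncomputable def risingFactorial (y : ℝ) (k : ℕ) : ℝ := ∏ i ∈ Finset.range k, (y + i)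

/-- Partial-wave coefficient `B^a_{n,j}(r,μ,D)` of the hypergeometric amplitude,
normalized up to an inessential positive constant depending only on `j` and `D`. -/
noncomputable def B (a n j : ℕ) (r μ D : ℝ) : ℝ :=
  (1 / risingFactorial (r + 1) n) *
    ∫ x in (-1:ℝ)..1,
      (1 - x ^ 2) ^ ((D - 4) / 2 + (j : ℝ)) *
        iteratedDeriv j
          (fun y : ℝ =>
            risingFactorial (((n : ℝ) - 3 * μ) * y / 2 + (μ - (n : ℝ)) / 2 + r + 1) (n - 1 + a)) x

open Polynomial in
/-- Iterated derivative of a product with a linear factor. -/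
theorem iterate_derivative_mul_linear (p : ℝ[X]) (c d : ℝ) (k : ℕ) :
    derivative^[k + 1] (p * (C c * X + C d)) =
      derivative^[k + 1] p * (C c * X + C d) + (k + 1 : ℝ[X]) * C c * derivative^[k] p := by
  induction k with
  | zero => simp; ring
  | succ k ih =>
    rw [Function.iterate_succ_apply', ih, Function.iterate_succ_apply' _ (k + 1) p]
    simp [Function.iterate_succ_apply']
    ring

open Polynomial in
/-- The top two derivatives of a product of linear polynomials with common slope `c`. -/
theorem iterate_derivative_prod_linear (c : ℝ) (d : ℕ → ℝ) (N : ℕ) :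
    derivative^[N] (∏ i ∈ Finset.range N, (C c * X + C (d i))) = C (N.factorial * c ^ N) ∧
    derivative^[N] (∏ i ∈ Finset.range (N + 1), (C c * X + C (d i))) =
      C (N.factorial * c ^ N) *
        (C ((N + 1) * c) * X + C (∑ i ∈ Finset.range (N + 1), d i)) := by
  induction N with
  | zero => simp
  | succ N ih =>
    obtain ⟨-, h2⟩ := ih
    have h3 : derivative^[N + 1] (∏ i ∈ Finset.range (N + 1), (C c * X + C (d i))) =
        C ((N + 1).factorial * c ^ (N + 1)) := by
      rw [Function.iterate_succ_apply', h2, derivative_C_mul]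
      simp [Nat.factorial_succ]
      ring
    refine ⟨h3, ?_⟩
    rw [Finset.prod_range_succ, iterate_derivative_mul_linear, h3, h2,
      Finset.sum_range_succ _ (N + 1)]
    simp [Nat.factorial_succ]
    ring

open Polynomial in
theorem iteratedDeriv_polynomial_eval (p : ℝ[X]) (k : ℕ) :
    iteratedDeriv k (fun y => p.eval y) = fun y => (derivative^[k] p).eval y := by
  induction k with
  | zero => simp
  | succ k ih =>
    rw [iteratedDeriv_succ, ih]
    funext y
    rw [Polynomial.deriv, Function.iterate_succ_apply']

open Polynomial in
theorem risingFactorial_linear_eq_eval (c e y : ℝ) (N : ℕ) :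
    risingFactorial (c * y + e) N =
      (∏ i ∈ Finset.range N, (C c * X + C (e + (i : ℝ)))).eval y := by
  simp [risingFactorial, eval_prod, add_assoc]

theorem iteratedDeriv_risingFactorial_top (c e x : ℝ) (N : ℕ) :
    iteratedDeriv N (fun y : ℝ => risingFactorial (c * y + e) N) x = N.factorial * c ^ N := by
  simp_rw [risingFactorial_linear_eq_eval, iteratedDeriv_polynomial_eval,
    (iterate_derivative_prod_linear c (fun i => e + (i : ℝ)) N).1]
  simp

theorem sum_range_add_natCast (e : ℝ) (N : ℕ) :
    ∑ i ∈ Finset.range (N + 1), (e + (i : ℝ)) = (N + 1) * (e + N / 2) := by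
  induction N with
  | zero => simp
  | succ N ih =>
    rw [Finset.sum_range_succ, ih]
    push_cast
    ring

theorem iteratedDeriv_risingFactorial_subtop (c e x : ℝ) (N : ℕ) :
    iteratedDeriv N (fun y : ℝ => risingFactorial (c * y + e) (N + 1)) x =
      (N + 1).factorial * c ^ N * (c * x + (e + N / 2)) := by
  simp_rw [risingFactorial_linear_eq_eval, iteratedDeriv_polynomial_eval,
    (iterate_derivative_prod_linear c (fun i => e + (i : ℝ)) N).2, sum_range_add_natCast]
  simp [Nat.factorial_succ]
  ring

theorem continuous_one_sub_sq_rpow {s : ℝ} (hs : 0 ≤ s) :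
    Continuous fun x : ℝ => (1 - x ^ 2) ^ s :=
  (by fun_prop : Continuous fun x : ℝ => 1 - x ^ 2).rpow_const fun _ => Or.inr hs

theorem integral_one_sub_sq_rpow_pos {s : ℝ} (hs : 0 ≤ s) :
    0 < ∫ x in (-1 : ℝ)..1, (1 - x ^ 2) ^ s := by
  refine intervalIntegral.intervalIntegral_pos_of_pos_on
    ((continuous_one_sub_sq_rpow hs).intervalIntegrable _ _) (fun x hx => ?_) (by norm_num)
  exact Real.rpow_pos_of_pos (by nlinarith [hx.1, hx.2]) _

theorem integral_one_sub_sq_rpow_mul_self (s : ℝ) :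
    ∫ x in (-1 : ℝ)..1, (1 - x ^ 2) ^ s * x = 0 := by
  have h := intervalIntegral.integral_comp_neg (a := (-1 : ℝ)) (b := 1)
    (fun x : ℝ => (1 - x ^ 2) ^ s * x)
  simp only [neg_sq, mul_neg, intervalIntegral.integral_neg, neg_neg] at h
  linarith

theorem integral_one_sub_sq_rpow_mul_linear {s : ℝ} (hs : 0 ≤ s) (k c t : ℝ) :
    ∫ x in (-1 : ℝ)..1, (1 - x ^ 2) ^ s * (k * (c * x + t)) =
      k * t * ∫ x in (-1 : ℝ)..1, (1 - x ^ 2) ^ s := by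
  have hw := continuous_one_sub_sq_rpow hs
  have h : ∀ x : ℝ, (1 - x ^ 2) ^ s * (k * (c * x + t)) =
      k * c * ((1 - x ^ 2) ^ s * x) + k * t * (1 - x ^ 2) ^ s := fun x => by ring
  simp_rw [h]
  rw [intervalIntegral.integral_add
      (Continuous.intervalIntegrable (by fun_prop) _ _)
      (Continuous.intervalIntegrable (by fun_prop) _ _),
    intervalIntegral.integral_const_mul, intervalIntegral.integral_const_mul,
    integral_one_sub_sq_rpow_mul_self]
  ring

/-- The coefficient with maximal spin has the sign of `(r + 1)_(n)`. -/
theorem B_top_neg {a n : ℕ} {r μ D : ℝ} (hD : 4 ≤ D) (hn : 3 * μ < n)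
    (hr : risingFactorial (r + 1) n < 0) : B a n (n - 1 + a) r μ D < 0 := by
  set N := n - 1 + a with hN
  have hs : 0 ≤ (D - 4) / 2 + (N : ℝ) := by
    have : (0 : ℝ) ≤ N := N.cast_nonneg
    linarith
  have hlin : ∀ y : ℝ, ((n : ℝ) - 3 * μ) * y / 2 + (μ - (n : ℝ)) / 2 + r + 1 =
      ((n : ℝ) - 3 * μ) / 2 * y + ((μ - (n : ℝ)) / 2 + r + 1) := fun y => by ring
  have hc : 0 < ((n : ℝ) - 3 * μ) / 2 := by linarith
  simp only [B, ← hN, hlin, iteratedDeriv_risingFactorial_top,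
    intervalIntegral.integral_mul_const]
  exact mul_neg_of_neg_of_pos (one_div_neg.2 hr)
    (mul_pos (integral_one_sub_sq_rpow_pos hs) (by positivity))

/-- The coefficient with next-to-maximal spin has the sign of `(2 r + μ + a) (r + 1)_(n)`. -/
theorem B_subtop_neg {a n : ℕ} {r μ D : ℝ} (hD : 4 ≤ D) (hn : 3 * μ < n) (hn2 : 2 ≤ n)
    (h : 2 * r + μ + a < 0) (hr : 0 < risingFactorial (r + 1) n) :
    B a n (n - 2 + a) r μ D < 0 := by
  obtain ⟨N, hN⟩ : ∃ N, N = n - 2 + a := ⟨_, rfl⟩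
  have hN1 : n - 1 + a = N + 1 := by omega
  have hNr : (N : ℝ) = n - 2 + a := by
    rw [hN]
    push_cast [Nat.cast_sub hn2]
    ring
  have hs : 0 ≤ (D - 4) / 2 + (N : ℝ) := by
    have : (0 : ℝ) ≤ N := N.cast_nonneg
    linarith
  have hlin : ∀ y : ℝ, ((n : ℝ) - 3 * μ) * y / 2 + (μ - (n : ℝ)) / 2 + r + 1 =
      ((n : ℝ) - 3 * μ) / 2 * y + ((μ - (n : ℝ)) / 2 + r + 1) := fun y => by ring
  have hc : 0 < ((n : ℝ) - 3 * μ) / 2 := by linarith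
  have ht : (μ - (n : ℝ)) / 2 + r + 1 + (N : ℝ) / 2 < 0 := by
    rw [hNr]
    linarith
  simp only [B, ← hN, hN1, hlin, iteratedDeriv_risingFactorial_subtop,
    integral_one_sub_sq_rpow_mul_linear hs]
  exact mul_neg_of_pos_of_neg (one_div_pos.2 hr)
    (mul_neg_of_neg_of_pos (mul_neg_of_pos_of_neg (by positivity) ht)
      (integral_one_sub_sq_rpow_pos hs))

theorem risingFactorial_ne_zero {r : ℝ} (hr : -1 < r ∨ ∀ m : ℤ, (m : ℝ) ≠ r) (n : ℕ) :
    risingFactorial (r + 1) n ≠ 0 := by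
  refine Finset.prod_ne_zero_iff.2 fun i _ hi => ?_
  rcases hr with hr | hr
  · have : (0 : ℝ) ≤ i := i.cast_nonneg
    linarith
  · refine hr (-1 - i) ?_
    push_cast
    linarith

theorem risingFactorial_neg_of_even_floor {r : ℝ} (hr : ∀ m : ℤ, (m : ℝ) ≠ r) (hr1 : r < -1)
    (he : Even ⌊r⌋) {n : ℕ} (hn : -r ≤ n) : risingFactorial (r + 1) n < 0 := by
  have hle := Int.floor_le r
  have hlt := Int.lt_floor_add_one r
  have hfl : ⌊r⌋ < -1 := Int.floor_lt.2 (by exact_mod_cast hr1)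
  have hflr : (⌊r⌋ : ℝ) < r := lt_of_le_of_ne hle (hr _)
  obtain ⟨m, hm⟩ : ∃ m : ℕ, (m : ℤ) = -⌊r⌋ - 1 := ⟨_, Int.toNat_of_nonneg (by omega)⟩
  have hmr : (m : ℝ) = -⌊r⌋ - 1 := by exact_mod_cast hm
  have hodd : Odd m := by
    obtain ⟨k, hk⟩ := he
    rw [Nat.odd_iff]
    omega
  have hmn : m ≤ n := by
    have : (m : ℝ) < n := by linarith
    exact_mod_cast this.le
  obtain ⟨t, rfl⟩ := Nat.exists_eq_add_of_le hmn
  rw [risingFactorial, Finset.prod_range_add]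
  refine mul_neg_of_neg_of_pos ?_ (Finset.prod_pos fun i _ => ?_)
  · have hpos : 0 < ∏ i ∈ Finset.range m, -(r + 1 + (i : ℝ)) := by
      refine Finset.prod_pos fun i hi => ?_
      have : (i : ℝ) + 1 ≤ m := by exact_mod_cast Finset.mem_range.1 hi
      linarith
    rw [Finset.prod_neg, Finset.card_range, hodd.neg_one_pow] at hpos
    linarith
  · have : (0 : ℝ) ≤ i := i.cast_nonneg
    push_cast
    linarith

/-- Theorem 1: non-unitarity of the hypergeometric amplitude. -/
theorem non_unitarity_theorem1 (a : ℕ) (ha : a = 0 ∨ a = 1) (D : ℝ) (hD : 4 ≤ D)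
    (r μ : ℝ) (hr : -1 < r ∨ ∀ m : ℤ, (m : ℝ) ≠ r)
    (h : 2 * r + μ + a < 0 ∨ (r < -1 ∧ Even ⌊r⌋)) :
    ∃ n j : ℕ, 1 ≤ n ∧ 3 * μ ≤ (n : ℝ) ∧ j ≤ n - 1 + a ∧ B a n j r μ D < 0 := by
  obtain ⟨n, hn⟩ := exists_nat_gt (max (3 * μ) (max (-r) 2))
  obtain ⟨hn1, hn'⟩ := max_lt_iff.1 hn
  obtain ⟨hn2, hn3⟩ := max_lt_iff.1 hn'
  have hn4 : 2 ≤ n := by exact_mod_cast hn3.le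
  have hcases : risingFactorial (r + 1) n < 0 ∨
      (0 < risingFactorial (r + 1) n ∧ 2 * r + μ + a < 0) := by
    rcases h with h | ⟨hr1, he⟩
    · exact (risingFactorial_ne_zero hr n).lt_or_gt.imp_right fun h' => ⟨h', h⟩
    · exact Or.inl (risingFactorial_neg_of_even_floor
        (hr.resolve_left (by linarith)) hr1 he hn2.le)
  rcases hcases with hneg | ⟨hpos, hlt⟩
  · exact ⟨n, n - 1 + a, by omega, hn1.le, le_rfl, B_top_neg hD hn1 hneg⟩
  · exact ⟨n, n - 2 + a, by omega, hn1.le, by omega, B_subtop_neg hD hn1 hn4 hlt hpos⟩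
end

section
/- Root spacing of derivatives of the rising-factorial polynomial (item (1) in the proof of Theorem 2). Let n ≥ 1 and 0 ≤ j ≤ n-1 be integers and let p(y) = ∏_{i=0}^{n-1} (y+i), regarded as a real polynomial. Then any two distinct real roots u ≠ v of the j-th derivative p^{(j)} satisfy |u - v| ≥ 1. -/
/-- The rising-factorial polynomial `p(y) = y (y+1) ⋯ (y+n-1)`. -/
noncomputable def risingPoly (n : ℕ) : Polynomial ℝ :=
  ∏ i ∈ Finset.range n, (Polynomial.X + Polynomial.C (i : ℝ))

open Polynomial in
/-- `p` has degree `m` and `m` real roots, any two of which are at least `1` apart. -/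
def HasUnitGapRoots (m : ℕ) (p : ℝ[X]) : Prop :=
  ∃ c : ℝ, c ≠ 0 ∧ ∃ r : ℕ → ℝ, (∀ i j, i < j → j < m → r i + 1 ≤ r j) ∧
    p = C c * ∏ i ∈ Finset.range m, (X - C (r i))

open Polynomial in
theorem eq_C_mul_prod_of_natDegree_le {K : Type*} [Field K] {m : ℕ} {p : K[X]} {s : ℕ → K}
    (hdeg : p.natDegree ≤ m) (hinj : Set.InjOn s (Finset.range m))
    (hs : ∀ i < m, p.IsRoot (s i)) :
    ∃ c : K, p = C c * ∏ i ∈ Finset.range m, (X - C (s i)) := by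
  obtain ⟨q, hq⟩ : ∏ i ∈ Finset.range m, (X - C (s i)) ∣ p := by
    refine Finset.prod_dvd_of_coprime (fun i hi j hj hij => ?_) fun i hi =>
      dvd_iff_isRoot.mpr (hs i (Finset.mem_range.mp hi))
    exact isCoprime_X_sub_C_of_isUnit_sub (sub_ne_zero.mpr (hinj.ne hi hj hij)).isUnit
  have hmonic : (∏ i ∈ Finset.range m, (X - C (s i))).Monic :=
    monic_prod_of_monic _ _ fun i _ => monic_X_sub_C _
  rcases eq_or_ne q 0 with rfl | hq0
  · exact ⟨0, by simp [hq]⟩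
  · have h := hmonic.natDegree_mul' hq0
    rw [← hq, natDegree_prod_of_monic _ _ fun i _ => monic_X_sub_C _] at h
    simp only [natDegree_X_sub_C, Finset.sum_const, Finset.card_range, smul_eq_mul,
      mul_one] at h
    refine ⟨q.coeff 0, ?_⟩
    rw [← eq_C_of_natDegree_eq_zero (by omega : q.natDegree = 0), mul_comm, ← hq]

open Polynomial in
theorem eval_derivative_prod_X_sub_C {K ι : Type*} [Field K] [DecidableEq ι]
    (t : Finset ι) (r : ι → K) {x : K} (hx : ∀ i ∈ t, x ≠ r i) :
    (derivative (∏ i ∈ t, (X - C (r i)))).eval x =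
      (∏ i ∈ t, (x - r i)) * ∑ i ∈ t, 1 / (x - r i) := by
  rw [derivative_prod_finset, eval_finsetSum, Finset.mul_sum]
  refine Finset.sum_congr rfl fun i hi => ?_
  have := sub_ne_zero.mpr (hx i hi)
  rw [← Finset.mul_prod_erase t _ hi]
  simp [eval_prod]
  field_simp

theorem le_of_forall_add_one_le {m : ℕ} {r : ℕ → ℝ} (hr : ∀ i j, i < j → j < m → r i + 1 ≤ r j)
    {i j : ℕ} (hij : i ≤ j) (hj : j < m) : r i ≤ r j := by
  rcases hij.eq_or_lt with rfl | h
  · exact le_rfl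
  · linarith [hr i j h hj]

/-- Riesz's comparison of the logarithmic derivative at two points closer than the root gap. -/
theorem sum_one_div_sub_lt_of_lt_add_one {k a : ℕ} {r : ℕ → ℝ} {u v : ℝ}
    (hr : ∀ i j, i < j → j < k + 1 → r i + 1 ≤ r j) (ha : a + 1 < k)
    (hu : u < r (a + 1)) (hv : r (a + 1) < v) (huv : v < u + 1) :
    ∑ i ∈ Finset.range (k + 1), 1 / (u - r i) < ∑ i ∈ Finset.range (k + 1), 1 / (v - r i) := by
  have hmono := fun i j => le_of_forall_add_one_le hr (i := i) (j := j)
  rw [Finset.sum_range_succ, Finset.sum_range_succ']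
  have hsum : ∑ i ∈ Finset.range k, 1 / (u - r i) ≤
      ∑ i ∈ Finset.range k, 1 / (v - r (i + 1)) := by
    refine Finset.sum_le_sum fun i hi => ?_
    have hik := Finset.mem_range.mp hi
    have hgap := hr i (i + 1) (by omega) (by omega)
    rcases le_or_gt i a with h | h
    · have := hmono (i + 1) (a + 1) (by omega) (by omega)
      exact one_div_le_one_div_of_le (by linarith) (by linarith)
    · have := hmono (a + 1) i (by omega) (by omega)
      exact one_div_le_one_div_of_neg_of_le (by linarith) (by linarith)
  have hlast : 1 / (u - r k) < 0 :=
    one_div_neg.mpr (by linarith [hmono (a + 1) k (by omega) (by omega)])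
  have hfirst : 0 < 1 / (v - r 0) :=
    one_div_pos.mpr (by linarith [hmono 0 (a + 1) (by omega) (by omega)])
  linarith

open Polynomial in
theorem HasUnitGapRoots.derivative {k : ℕ} {p : ℝ[X]} (h : HasUnitGapRoots (k + 1) p) :
    HasUnitGapRoots k (derivative p) := by
  obtain ⟨c, hc, r, hr, rfl⟩ := h
  set q : ℝ[X] := ∏ i ∈ Finset.range (k + 1), (X - C (r i)) with hq
  have hmono := fun i j => le_of_forall_add_one_le hr (i := i) (j := j)
  have hqdeg : q.natDegree = k + 1 := by
    rw [hq, natDegree_prod_of_monic _ _ fun i _ => monic_X_sub_C _]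
    simp
  have hroot : ∀ i < k + 1, q.eval (r i) = 0 := fun i hi => by
    rw [hq, eval_prod]
    exact Finset.prod_eq_zero (Finset.mem_range.mpr hi) (by simp)
  have hrolle : ∀ i, ∃ x, i < k →
      r i < x ∧ x < r (i + 1) ∧ (Polynomial.derivative q).eval x = 0 := fun i => by
    by_cases hi : i < k
    · have hlt : r i < r (i + 1) := by linarith [hr i (i + 1) (by omega) (by omega)]
      obtain ⟨x, hx, hx'⟩ := exists_deriv_eq_zero hlt q.continuous.continuousOn
        ((hroot i (by omega)).trans (hroot (i + 1) (by omega)).symm)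
      exact ⟨x, fun _ => ⟨hx.1, hx.2, by rwa [Polynomial.deriv] at hx'⟩⟩
    · exact ⟨0, fun h => absurd h hi⟩
  choose s hs using hrolle
  have hlog : ∀ a < k, ∑ i ∈ Finset.range (k + 1), 1 / (s a - r i) = 0 := fun a ha => by
    obtain ⟨h1, h2, h3⟩ := hs a ha
    have hne : ∀ i ∈ Finset.range (k + 1), s a ≠ r i := fun i hi => by
      have hik := Finset.mem_range.mp hi
      rcases le_or_gt i a with h | h
      · exact ((hmono i a h (by omega)).trans_lt h1).ne'
      · exact (h2.trans_le (hmono (a + 1) i h hik)).ne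
    rw [hq, eval_derivative_prod_X_sub_C _ _ hne] at h3
    exact (mul_eq_zero.mp h3).resolve_left
      (Finset.prod_ne_zero_iff.mpr fun i hi => sub_ne_zero.mpr (hne i hi))
  have hgap : ∀ a b, a < b → b < k → s a + 1 ≤ s b := fun a b hab hb => by
    obtain ⟨-, ha2, -⟩ := hs a (by omega)
    obtain ⟨hb1, -, -⟩ := hs b hb
    rcases (Nat.succ_le_of_lt hab).eq_or_lt with rfl | h
    · by_contra! hlt
      have := sum_one_div_sub_lt_of_lt_add_one hr hb ha2 hb1 hlt
      rw [hlog a (by omega), hlog _ hb] at this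
      exact this.false
    · linarith [hr (a + 1) b h (by omega)]
  obtain ⟨d, hd⟩ := eq_C_mul_prod_of_natDegree_le (m := k) (p := Polynomial.derivative q) (s := s)
    ((natDegree_derivative_le q).trans (by omega))
    (fun i hi j hj hij => by
      have hi' : i < k := by simpa using hi
      have hj' : j < k := by simpa using hj
      rcases lt_trichotomy i j with h | h | h
      · linarith [hgap i j h hj']
      · exact h
      · linarith [hgap j i h hi'])
    fun i hi => (hs i hi).2.2
  have hd0 : d ≠ 0 := by
    rintro rfl
    have := derivative_eq_zero.mp (hd.trans (by simp))
    omega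
  exact ⟨c * d, mul_ne_zero hc hd0, s, hgap, by
    rw [derivative_C_mul, hd, C_mul, mul_assoc]⟩

open Polynomial in
theorem HasUnitGapRoots.iterate_derivative {m j : ℕ} {p : ℝ[X]}
    (h : HasUnitGapRoots (m + j) p) : HasUnitGapRoots m (Polynomial.derivative^[j] p) := by
  induction j generalizing p with
  | zero => exact h
  | succ j ih => exact ih h.derivative

open Polynomial in
theorem HasUnitGapRoots.one_le_abs_sub {m : ℕ} {p : ℝ[X]} (h : HasUnitGapRoots m p) {u v : ℝ}
    (hu : p.IsRoot u) (hv : p.IsRoot v) (huv : u ≠ v) : 1 ≤ |u - v| := by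
  obtain ⟨c, hc, r, hr, rfl⟩ := h
  have hmem : ∀ x, (C c * ∏ i ∈ Finset.range m, (X - C (r i))).IsRoot x →
      ∃ i < m, x = r i := fun x hx => by
    simpa [IsRoot, eval_prod, hc, Finset.prod_eq_zero_iff, sub_eq_zero] using hx
  obtain ⟨i, hi, rfl⟩ := hmem u hu
  obtain ⟨j, hj, rfl⟩ := hmem v hv
  rcases lt_trichotomy i j with h | rfl | h
  · exact le_abs.mpr (Or.inr (by linarith [hr i j h hj]))
  · exact absurd rfl huv
  · exact le_abs.mpr (Or.inl (by linarith [hr j i h hi]))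

theorem hasUnitGapRoots_risingPoly (n : ℕ) : HasUnitGapRoots n (risingPoly n) := by
  refine ⟨1, one_ne_zero, fun i => (i : ℝ) + 1 - n, fun i j hij _ => ?_, ?_⟩
  · have : (i : ℝ) + 1 ≤ j := by exact_mod_cast hij
    linarith
  · rw [risingPoly, ← Finset.prod_range_reflect, map_one, one_mul]
    refine Finset.prod_congr rfl fun i hi => ?_
    have hin : i + 1 ≤ n := Finset.mem_range.mp hi
    rw [Nat.sub_sub, add_comm 1 i, Nat.cast_sub hin, sub_eq_add_neg Polynomial.X,
      ← Polynomial.C_neg, neg_sub]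
    push_cast
    rfl


/-- Item (1) in the proof of Theorem 2: any two distinct real roots of the `j`-th
derivative of the rising-factorial polynomial are at least `1` apart. -/
theorem root_spacing_of_deriv_risingPoly (n j : ℕ) (hn : 1 ≤ n) (hj : j ≤ n - 1)
    (u v : ℝ) (hu : (Polynomial.derivative^[j] (risingPoly n)).IsRoot u)
    (hv : (Polynomial.derivative^[j] (risingPoly n)).IsRoot v) (huv : u ≠ v) :
    1 ≤ |u - v| := by
  obtain ⟨m, rfl⟩ := Nat.exists_eq_add_of_le' (hj.trans (Nat.sub_le n 1))
  exact (hasUnitGapRoots_risingPoly _).iterate_derivative.one_le_abs_sub hu hv huv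
end

section
/- Largest root of the derivative dominates the average of the two largest roots (item (2) in the proof of Theorem 2). Let p be a real polynomial of degree d ≥ 2 all of whose roots are real. Let ρ₀ be the largest root of p and let ρ₁ be the largest root of p divided by (X - ρ₀) (i.e., the second-largest root of p counted with multiplicity, ρ₀ ≥ ρ₁). Then the derivative p' has a real root ρ with ρ ≥ (ρ₀ + ρ₁)/2. -/
open Polynomial in
/-- A split real polynomial does not change sign to the right of all its roots. -/
theorem Polynomial.Splits.eval_mul_eval_pos_of_roots_lt {r : ℝ[X]} (hr : r.Splits) (hr0 : r ≠ 0)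
    {x y : ℝ} (hx : ∀ z ∈ r.roots, z < x) (hy : ∀ z ∈ r.roots, z < y) :
    0 < r.eval x * r.eval y := by
  have hpos : ∀ w : ℝ, (∀ z ∈ r.roots, z < w) → 0 < (r.roots.map fun z ↦ w - z).prod := by
    intro w hw
    refine Multiset.prod_pos fun t ht ↦ ?_
    obtain ⟨z, hz, rfl⟩ := Multiset.mem_map.1 ht
    exact sub_pos.2 (hw z hz)
  have hc : 0 < r.leadingCoeff * r.leadingCoeff :=
    mul_self_pos.2 (leadingCoeff_ne_zero.2 hr0)
  rw [hr.eval_eq_prod_roots x, hr.eval_eq_prod_roots y, mul_mul_mul_comm]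
  exact mul_pos hc (mul_pos (hpos x hx) (hpos y hy))

open Polynomial in
/-- To the right of all its roots, a split real polynomial and its derivative have the same
sign. -/
theorem Polynomial.Splits.eval_mul_eval_derivative_nonneg_of_roots_lt {r : ℝ[X]} (hr : r.Splits)
    (hr0 : r ≠ 0) {x y : ℝ} (hx : ∀ z ∈ r.roots, z < x) (hy : ∀ z ∈ r.roots, z < y) :
    0 ≤ r.eval x * r.derivative.eval y := by
  have hne : r.eval y ≠ 0 := fun h ↦ (hy y ((mem_roots hr0).2 h)).false
  rw [hr.eval_derivative_eq_eval_mul_sum hne, ← mul_assoc]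
  refine mul_nonneg (hr.eval_mul_eval_pos_of_roots_lt hr0 hx hy).le ?_
  refine Multiset.sum_nonneg fun t ht ↦ ?_
  obtain ⟨z, hz, rfl⟩ := Multiset.mem_map.1 ht
  exact one_div_nonneg.2 (sub_pos.2 (hy z hz)).le

/-- Item (2) in the proof of Theorem 2: for a real polynomial with all real roots,
the derivative has a root at least as large as the average of the two largest roots. -/
theorem deriv_root_ge_avg_two_largest_roots (p : Polynomial ℝ) (hdeg : 2 ≤ p.natDegree)
    (hsplit : p.roots.card = p.natDegree)
    (ρ₀ ρ₁ : ℝ) (h0 : ρ₀ ∈ p.roots) (h0max : ∀ x ∈ p.roots, x ≤ ρ₀)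
    (h1 : ρ₁ ∈ (p /ₘ (Polynomial.X - Polynomial.C ρ₀)).roots)
    (h1max : ∀ x ∈ (p /ₘ (Polynomial.X - Polynomial.C ρ₀)).roots, x ≤ ρ₁) :
    ∃ ρ : ℝ, (Polynomial.derivative p).IsRoot ρ ∧ (ρ₀ + ρ₁) / 2 ≤ ρ := by
  open Polynomial in
  have hsp : p.Splits := splits_iff_card_roots.2 hsplit
  have hp0 : p ≠ 0 := ne_zero_of_mem_roots h0
  have hq := mul_divByMonic_eq_iff_isRoot.2 (isRoot_of_mem_roots h0)
  set q := p /ₘ (X - C ρ₀)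
  have hr := mul_divByMonic_eq_iff_isRoot.2 (isRoot_of_mem_roots h1)
  set r := q /ₘ (X - C ρ₁)
  have hq0 : q ≠ 0 := ne_zero_of_mem_roots h1
  have hr0 : r ≠ 0 := right_ne_zero_of_mul (hr.trans_ne hq0)
  have hrq : r ∣ q := ⟨X - C ρ₁, by rw [← hr, mul_comm]⟩
  have hqp : q ∣ p := ⟨X - C ρ₀, by rw [← hq, mul_comm]⟩
  have hrs : r.Splits := hsp.of_dvd hp0 (hrq.trans hqp)
  have hroots : ∀ z ∈ r.roots, z ≤ ρ₁ := fun z hz ↦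
    h1max z (Multiset.mem_of_le (roots.le_of_dvd hq0 hrq) hz)
  have hle : ρ₁ ≤ ρ₀ := h0max ρ₁ (Multiset.mem_of_le (roots.le_of_dvd hp0 hqp) h1)
  have hder : ∀ x, p.derivative.eval x =
      (2 * x - ρ₀ - ρ₁) * r.eval x + (x - ρ₀) * (x - ρ₁) * r.derivative.eval x := by
    intro x
    rw [← hq, ← hr]
    simp
    ring
  obtain rfl | hlt := hle.eq_or_lt
  · exact ⟨ρ₁, by rw [IsRoot, hder]; ring, by linarith⟩
  have hnn := hrs.eval_mul_eval_derivative_nonneg_of_roots_lt hr0 (x := ρ₀) (y := (ρ₀ + ρ₁) / 2)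
    (fun z hz ↦ (hroots z hz).trans_lt hlt)
    (fun z hz ↦ (hroots z hz).trans_lt (by linarith))
  have hprod : p.derivative.eval ((ρ₀ + ρ₁) / 2) * p.derivative.eval ρ₀ ≤ 0 := by
    have hcube : 0 ≤ (ρ₀ - ρ₁) ^ 3 := pow_nonneg (sub_nonneg.2 hle) 3
    rw [hder, hder]
    linarith [mul_nonneg hcube hnn]
  have hmem : (0 : ℝ) ∈ Set.uIcc (p.derivative.eval ((ρ₀ + ρ₁) / 2)) (p.derivative.eval ρ₀) := by
    rw [Set.mem_uIcc]
    obtain h | h := mul_nonpos_iff.1 hprod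
    · exact Or.inr h.symm
    · exact Or.inl h
  obtain ⟨ρ, hρ, hρ0⟩ := intermediate_value_uIcc p.derivative.continuousOn hmem
  rw [Set.uIcc_of_le (by linarith)] at hρ
  exact ⟨ρ, hρ0, hρ.1⟩
end

section
/- Positivity at spin zero in D = 4 (Theorem 8). Let r, μ be real with r ≥ μ and 2r + μ + 1 ≥ 0. Then for every integer n ≥ 1 with n ≥ 3μ, one has B^1_{n,0}(r,μ,4) ≥ 0. -/
open MeasureTheory

/-- Partial integrals of an oscillating function whose successive humps alternate in sign and
decrease in size lie between zero and the integral of the first hump. -/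
lemma integral_mem_Icc_of_alternating (M : ℕ) : ∀ f : ℝ → ℝ, Continuous f →
    (∀ y ∈ Set.Icc (0 : ℝ) 1, 0 ≤ f y) →
    (∀ y : ℝ, 0 ≤ y → y + 1 ≤ M → ∃ θ : ℝ, 0 ≤ θ ∧ θ ≤ 1 ∧ f (y + 1) = -(θ * f y)) →
    ∀ t : ℝ, 0 ≤ t → t ≤ M →
      0 ≤ ∫ x in (0 : ℝ)..t, f x ∧ ∫ x in (0 : ℝ)..t, f x ≤ ∫ x in (0 : ℝ)..1, f x := by
  induction M with
  | zero =>
    intro f _ hpos _ t ht0 ht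
    obtain rfl : t = 0 := le_antisymm (by simpa using ht) ht0
    simpa using intervalIntegral.integral_nonneg zero_le_one hpos
  | succ M ih =>
    intro f hf hpos hrec t ht0 ht
    push_cast at ht hrec
    rcases le_total t 1 with h1 | h1
    · have hsplit := intervalIntegral.integral_add_adjacent_intervals
        (hf.intervalIntegrable (μ := volume) 0 t) (hf.intervalIntegrable t 1)
      have hl : 0 ≤ ∫ x in (0 : ℝ)..t, f x :=
        intervalIntegral.integral_nonneg ht0 fun x hx => hpos x ⟨hx.1, hx.2.trans h1⟩
      have hr : 0 ≤ ∫ x in t..1, f x :=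
        intervalIntegral.integral_nonneg h1 fun x hx => hpos x ⟨ht0.trans hx.1, hx.2⟩
      constructor <;> linarith
    · rcases Nat.eq_zero_or_pos M with rfl | hM
      · obtain rfl : t = 1 := le_antisymm (by simpa using ht) h1
        exact ⟨intervalIntegral.integral_nonneg zero_le_one hpos, le_rfl⟩
      have hM' : (1 : ℝ) ≤ M := by exact_mod_cast hM
      have hg : Continuous fun x => -f (x + 1) := by fun_prop
      have hgle : ∀ y ∈ Set.Icc (0 : ℝ) 1, 0 ≤ -f (y + 1) ∧ -f (y + 1) ≤ f y := by
        intro y hy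
        obtain ⟨θ, h0, h1, he⟩ := hrec y hy.1 (by linarith [hy.2])
        have := hpos y hy
        rw [he]
        constructor <;> nlinarith
      obtain ⟨hlo, hhi⟩ := ih (fun x => -f (x + 1)) hg (fun y hy => (hgle y hy).1)
        (fun y hy0 hy => by
          obtain ⟨θ, h0, h1, he⟩ := hrec (y + 1) (by linarith) (by linarith)
          exact ⟨θ, h0, h1, by rw [he]; ring⟩) (t - 1) (by linarith) (by linarith)
      have hhump : ∫ x in (0 : ℝ)..1, -f (x + 1) ≤ ∫ x in (0 : ℝ)..1, f x :=
        intervalIntegral.integral_mono_on zero_le_one (hg.intervalIntegrable _ _)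
          (hf.intervalIntegrable _ _) fun y hy => (hgle y hy).2
      have hshift : ∫ x in (0 : ℝ)..(t - 1), -f (x + 1) = -∫ x in (1 : ℝ)..t, f x := by
        rw [intervalIntegral.integral_neg, intervalIntegral.integral_comp_add_right]
        simp
      have hsplit := intervalIntegral.integral_add_adjacent_intervals
        (hf.intervalIntegrable (μ := volume) 0 1) (hf.intervalIntegrable 1 t)
      rw [hshift] at hlo hhi
      constructor <;> linarith

lemma continuous_risingFactorial (n : ℕ) : Continuous fun y => risingFactorial y n := by
  unfold risingFactorial
  fun_prop

lemma risingFactorial_nonneg {y : ℝ} (hy : 0 ≤ y) (n : ℕ) : 0 ≤ risingFactorial y n :=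
  Finset.prod_nonneg fun _ _ => by positivity

lemma risingFactorial_succ (y : ℝ) (n : ℕ) :
    risingFactorial y (n + 1) = risingFactorial y n * (y + n) :=
  Finset.prod_range_succ _ _

lemma risingFactorial_succ' (y : ℝ) (n : ℕ) :
    risingFactorial y (n + 1) = y * risingFactorial (y + 1) n := by
  unfold risingFactorial
  rw [Finset.prod_range_succ', mul_comm]
  congr 1
  · simp
  · refine Finset.prod_congr rfl fun i _ => ?_
    push_cast
    ring

lemma risingFactorial_le_of_le {x y : ℝ} (hx : 0 ≤ x) (hxy : x ≤ y) (n : ℕ) :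
    risingFactorial x n ≤ risingFactorial y n :=
  Finset.prod_le_prod (fun _ _ => by positivity) fun _ _ => by linarith

lemma risingFactorial_reflect (y : ℝ) (n : ℕ) :
    risingFactorial (1 - n - y) n = (-1) ^ n * risingFactorial y n := by
  unfold risingFactorial
  rw [← Finset.prod_range_reflect, ← Finset.card_range n, ← Finset.prod_const,
    Finset.card_range, ← Finset.prod_mul_distrib]
  refine Finset.prod_congr rfl fun i hi => ?_
  have hi' : i + 1 ≤ n := Finset.mem_range.mp hi
  rw [Nat.sub_sub, add_comm 1 i, Nat.cast_sub hi']
  push_cast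
  ring

/-- The antiderivative of `(y)_(n)` vanishing at the origin. -/
noncomputable def risingPrimitive (n : ℕ) (t : ℝ) : ℝ :=
  ∫ y in (0 : ℝ)..t, risingFactorial y n

lemma integral_risingFactorial (n : ℕ) (a b : ℝ) :
    ∫ y in a..b, risingFactorial y n = risingPrimitive n b - risingPrimitive n a :=
  (intervalIntegral.integral_interval_sub_left
    ((continuous_risingFactorial n).intervalIntegrable _ _)
    ((continuous_risingFactorial n).intervalIntegrable _ _)).symm

lemma risingPrimitive_neg (n : ℕ) (t : ℝ) :
    risingPrimitive n (-t) = ∫ x in (0 : ℝ)..t, -risingFactorial (-x) n := by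
  rw [intervalIntegral.integral_neg,
    intervalIntegral.integral_comp_neg (fun x => risingFactorial x n),
    integral_risingFactorial]
  simp [risingPrimitive]

lemma risingPrimitive_mono (n : ℕ) {a b : ℝ} (ha : 0 ≤ a) (hab : a ≤ b) :
    risingPrimitive n a ≤ risingPrimitive n b := by
  rw [← sub_nonneg, ← integral_risingFactorial]
  exact intervalIntegral.integral_nonneg hab fun x hx =>
    risingFactorial_nonneg (ha.trans hx.1) n

lemma risingPrimitive_reflect (n : ℕ) (y : ℝ) :
    risingPrimitive n (1 - n - y) =
      risingPrimitive n (1 - n) - (-1) ^ n * risingPrimitive n y := by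
  have h := intervalIntegral.integral_comp_sub_left (a := 0) (b := y)
    (fun x => risingFactorial x n) (1 - n : ℝ)
  simp only [risingFactorial_reflect, intervalIntegral.integral_const_mul, sub_zero,
    integral_risingFactorial] at h
  simp only [risingPrimitive, intervalIntegral.integral_same] at h ⊢
  linarith

lemma neg_risingFactorial_neg_nonneg {n : ℕ} (hn : 1 ≤ n) {x : ℝ} (h0 : 0 ≤ x) (h1 : x ≤ 1) :
    0 ≤ -risingFactorial (-x) n := by
  obtain ⟨m, rfl⟩ := Nat.exists_eq_add_of_le' hn
  rw [risingFactorial_succ']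
  have := mul_nonneg h0 (risingFactorial_nonneg (y := -x + 1) (by linarith) m)
  linarith

/-- On the right half of its zero range, the primitive oscillates between zero and its value
at `-1`. -/
lemma risingPrimitive_neg_mem_Icc {n : ℕ} (hn : 1 ≤ n) {t : ℝ} (ht0 : 0 ≤ t)
    (ht : t ≤ (n / 2 : ℕ)) :
    0 ≤ risingPrimitive n (-t) ∧ risingPrimitive n (-t) ≤ risingPrimitive n (-1) := by
  simp only [risingPrimitive_neg]
  refine integral_mem_Icc_of_alternating (n / 2) (fun x => -risingFactorial (-x) n)
    ((continuous_risingFactorial n).comp continuous_neg).neg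
    (fun y hy => neg_risingFactorial_neg_nonneg hn hy.1 hy.2) (fun y hy0 hy => ?_) t ht0 ht
  have hhalf : ((n / 2 : ℕ) : ℝ) ≤ n / 2 := Nat.cast_div_le
  have hden : 0 < (n : ℝ) - 1 - y := by linarith
  refine ⟨(1 + y) / (n - 1 - y), by positivity, (div_le_one hden).2 (by linarith), ?_⟩
  obtain ⟨m, rfl⟩ := Nat.exists_eq_add_of_le' hn
  rw [risingFactorial_succ' (-(y + 1)), risingFactorial_succ (-y)]
  push_cast at hden ⊢
  rw [show -(y + 1) + 1 = -y by ring]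
  field_simp
  ring

/-- The first positive hump of `(y)_(n)` dominates twice the adjacent negative hump. -/
lemma two_mul_risingPrimitive_neg_one_le {n : ℕ} (hn : 2 ≤ n) :
    2 * risingPrimitive n (-1) ≤ risingPrimitive n 1 := by
  obtain ⟨m, rfl⟩ := Nat.exists_eq_add_of_le' hn
  have hc := continuous_risingFactorial (m + 2)
  have hcn : Continuous fun x => -risingFactorial (-x) (m + 2) := (hc.comp continuous_neg).neg
  have hpoly : ∫ x in (0 : ℝ)..1, risingFactorial 2 m * (3 * x ^ 2 - x) =
      risingFactorial 2 m / 2 := by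
    rw [intervalIntegral.integral_const_mul, intervalIntegral.integral_sub
      (Continuous.intervalIntegrable (by fun_prop) _ _)
      (Continuous.intervalIntegrable (by fun_prop) _ _),
      intervalIntegral.integral_const_mul, integral_pow, integral_id]
    norm_num
    ring
  have hmono : ∫ x in (0 : ℝ)..1, risingFactorial 2 m * (3 * x ^ 2 - x) ≤
      ∫ x in (0 : ℝ)..1, (risingFactorial x (m + 2) - 2 * -risingFactorial (-x) (m + 2)) := by
    refine intervalIntegral.integral_mono_on zero_le_one
      (Continuous.intervalIntegrable (by fun_prop) _ _)
      ((hc.sub (hcn.const_mul 2)).intervalIntegrable _ _) fun x hx => ?_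
    obtain ⟨h0, h1⟩ := hx
    simp only [risingFactorial_succ']
    have hup := risingFactorial_le_of_le (x := 2) (y := x + 1 + 1) (by norm_num)
      (by linarith) m
    have hdown := risingFactorial_le_of_le (x := -x + 1 + 1) (y := 2) (by linarith)
      (by linarith) m
    have hu := mul_le_mul_of_nonneg_left hup (show 0 ≤ x * (x + 1) by positivity)
    have hd := mul_le_mul_of_nonneg_left hdown (mul_nonneg h0 (show 0 ≤ -x + 1 by linarith))
    nlinarith
  rw [hpoly, intervalIntegral.integral_sub (hc.intervalIntegrable _ _)
    ((hcn.const_mul 2).intervalIntegrable _ _), intervalIntegral.integral_const_mul,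
    ← risingPrimitive_neg] at hmono
  have := risingFactorial_nonneg (y := 2) (by norm_num) m
  change _ ≤ risingPrimitive (m + 2) 1 - _ at hmono
  linarith

lemma sub_one_half_le_div_two (n : ℕ) : ((n : ℝ) - 1) / 2 ≤ (n / 2 : ℕ) := by
  have : (n : ℝ) ≤ 2 * (n / 2 : ℕ) + 1 := by exact_mod_cast (by omega : n ≤ 2 * (n / 2) + 1)
  linarith

lemma risingPrimitive_nonneg {n : ℕ} (hn : 1 ≤ n) {t : ℝ} (ht : (1 - n : ℝ) / 2 ≤ t) :
    0 ≤ risingPrimitive n t := by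
  rcases le_total 0 t with h0 | h0
  · simpa [risingPrimitive] using risingPrimitive_mono n le_rfl h0
  · simpa using (risingPrimitive_neg_mem_Icc hn (t := -t) (by linarith)
      (by linarith [sub_one_half_le_div_two n])).1

/-- To the right of the centre of symmetry, the primitive is maximal at the right endpoint. -/
lemma risingPrimitive_le_of_center_le {n : ℕ} (hn : 1 ≤ n) {t A : ℝ}
    (ht : (1 - n : ℝ) / 2 ≤ t) (htA : t ≤ A) (hA : 1 ≤ A) :
    risingPrimitive n t ≤ risingPrimitive n A := by
  rcases le_or_gt 0 t with h0 | h0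
  · exact risingPrimitive_mono n h0 htA
  have hn2 : 2 ≤ n := by
    have : (1 : ℝ) < n := by linarith
    exact_mod_cast this
  have hbound := (risingPrimitive_neg_mem_Icc hn (t := -t) (by linarith)
    (by linarith [sub_one_half_le_div_two n]))
  rw [neg_neg] at hbound
  linarith [two_mul_risingPrimitive_neg_one_le hn2, risingPrimitive_mono n zero_le_one hA]

lemma risingPrimitive_le {n : ℕ} (hn : 1 ≤ n) {t A : ℝ} (htA : t ≤ A) (hA : 1 ≤ A)
    (hsum : 1 - (n : ℝ) ≤ t + A) : risingPrimitive n t ≤ risingPrimitive n A := by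
  rcases le_or_gt ((1 - n : ℝ) / 2) t with hc | hc
  · exact risingPrimitive_le_of_center_le hn hc htA hA
  have hn1 : (1 : ℝ) ≤ n := by exact_mod_cast hn
  have hc' : (1 - n : ℝ) / 2 ≤ 1 - n - t := by linarith
  have hrefl := risingPrimitive_reflect n (1 - n - t)
  rw [sub_sub_cancel] at hrefl
  rcases Nat.even_or_odd n with he | ho
  · have hn2 : 2 ≤ n := by
      obtain ⟨k, rfl⟩ := he
      omega
    have hcenter := risingPrimitive_reflect n ((1 - n) / 2)
    rw [he.neg_one_pow, one_mul, sub_half] at hcenter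
    rw [he.neg_one_pow, one_mul] at hrefl
    have hbound := (risingPrimitive_neg_mem_Icc hn (t := (n - 1) / 2) (by linarith)
      (sub_one_half_le_div_two n)).2
    rw [show -(((n : ℝ) - 1) / 2) = (1 - n) / 2 by ring] at hbound
    linarith [two_mul_risingPrimitive_neg_one_le hn2, risingPrimitive_mono n zero_le_one hA,
      risingPrimitive_nonneg hn hc']
  · have hend := risingPrimitive_reflect n (1 - n)
    have hzero : risingPrimitive n 0 = 0 := intervalIntegral.integral_same
    rw [ho.neg_one_pow, sub_self, hzero] at hend
    rw [ho.neg_one_pow] at hrefl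
    linarith [risingPrimitive_le_of_center_le hn hc' (by linarith) hA]

/-- Theorem 8: positivity at spin zero in `D = 4`. -/
theorem positivity_spin_zero_D4 (r μ : ℝ) (hrμ : μ ≤ r) (h : 0 ≤ 2 * r + μ + 1)
    (n : ℕ) (hn : 1 ≤ n) (hmass : 3 * μ ≤ (n : ℝ)) :
    0 ≤ B 1 n 0 r μ 4 := by
  unfold B
  refine mul_nonneg (one_div_nonneg.2 (risingFactorial_nonneg (by linarith) n)) ?_
  simp only [iteratedDeriv_zero, Nat.sub_add_cancel hn, CharP.cast_eq_zero, sub_self, zero_div,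
    add_zero, Real.rpow_zero, one_mul]
  rcases hmass.eq_or_lt with heq | hlt
  · refine intervalIntegral.integral_nonneg (by norm_num) fun x _ =>
      risingFactorial_nonneg ?_ n
    rw [← heq]
    linarith
  · have hpos : 0 < ((n : ℝ) - 3 * μ) / 2 := by linarith
    have hsub := intervalIntegral.integral_comp_mul_add (a := -1) (b := 1)
      (fun y => risingFactorial y n) hpos.ne' ((μ - n) / 2 + r + 1)
    have hform : ∀ x : ℝ, ((n : ℝ) - 3 * μ) * x / 2 + (μ - n) / 2 + r + 1 =
        ((n : ℝ) - 3 * μ) / 2 * x + ((μ - n) / 2 + r + 1) := fun x => by ring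
    simp only [hform]
    rw [hsub, integral_risingFactorial]
    refine mul_nonneg (inv_nonneg.2 hpos.le) (sub_nonneg.2 (risingPrimitive_le hn ?_ ?_ ?_)) <;>
      linarith
end

section
/- Fixed-spin large-n asymptotics, negative case (consequence of Theorem 9). Fix a natural number j, an even integer D ≥ 4, and real r, μ with r > -1 and 2r + μ + 1 > 0, and suppose there exists an odd natural number k ≥ 1 with k < μ - r < k + 1. Then there exists N such that B^1_{n,j}(r,μ,D) < 0 for all integers n ≥ N. -/
open MeasureTheory

open Filter Topology

/-- The product `(0 - b) (1 - b) ⋯ (n - 1 - b)`. -/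
noncomputable def nodeProd (n : ℕ) (b : ℝ) : ℝ := ∏ i ∈ Finset.range n, ((i : ℝ) - b)

theorem nodeProd_succ (n : ℕ) (b : ℝ) : nodeProd (n + 1) b = nodeProd n b * (n - b) :=
  Finset.prod_range_succ _ _

theorem continuous_nodeProd (n : ℕ) : Continuous (nodeProd n) := by
  unfold nodeProd
  fun_prop

theorem risingFactorial_neg (n : ℕ) (b : ℝ) : risingFactorial (-b) n = nodeProd n b :=
  Finset.prod_congr rfl fun _ _ => by ring

theorem abs_nodeProd_reflect (n : ℕ) (b : ℝ) : |nodeProd n (n - 1 - b)| = |nodeProd n b| := by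
  unfold nodeProd
  rw [Finset.abs_prod, Finset.abs_prod, ← Finset.prod_range_reflect]
  refine Finset.prod_congr rfl fun i hi => ?_
  have hi' : i + 1 ≤ n := Finset.mem_range.mp hi
  rw [Nat.sub_sub, add_comm 1 i, Nat.cast_sub hi', ← abs_neg]
  push_cast
  congr 1
  ring

theorem abs_nodeProd_add_one_mul (n : ℕ) (b : ℝ) :
    |nodeProd n (b + 1)| * |n - 1 - b| = |b + 1| * |nodeProd n b| := by
  have h := Finset.prod_range_succ (fun i : ℕ => (i : ℝ) - (b + 1)) n
  rw [Finset.prod_range_succ'] at h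
  rw [← abs_mul, ← abs_mul, ← abs_neg ((b + 1) * _)]
  congr 1
  have h2 : ∏ i ∈ Finset.range n, (((i + 1 : ℕ) : ℝ) - (b + 1)) = nodeProd n b :=
    Finset.prod_congr rfl fun _ _ => by push_cast; ring
  rw [h2] at h
  unfold nodeProd at h ⊢
  push_cast at h
  linarith

theorem abs_nodeProd_add_one_le {n : ℕ} {b : ℝ} (hb : 0 ≤ b) (hn : 2 * (b + 1) ≤ n) :
    |nodeProd n (b + 1)| ≤ |nodeProd n b| := by
  have h := abs_nodeProd_add_one_mul n b
  rw [abs_of_pos (by linarith : 0 < b + 1), abs_of_pos (by linarith : (0 : ℝ) < n - 1 - b)] at h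
  have h' : |nodeProd n (b + 1)| * (b + 1) ≤ |nodeProd n (b + 1)| * (n - 1 - b) :=
    mul_le_mul_of_nonneg_left (by linarith) (abs_nonneg _)
  nlinarith [abs_nonneg (nodeProd n (b + 1)), abs_nonneg (nodeProd n b)]

theorem abs_nodeProd_le_of_le_half {n K : ℕ} (hK : 1 ≤ K) {Z : ℝ}
    (hZ : ∀ b : ℝ, K - 1 ≤ b → b ≤ K → |nodeProd n b| ≤ Z) {b : ℝ}
    (hb : (K : ℝ) - 1 ≤ b) (hbn : 2 * b ≤ n) : |nodeProd n b| ≤ Z := by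
  have hK' : (1 : ℝ) ≤ K := by exact_mod_cast hK
  suffices H : ∀ m : ℕ, ∀ b : ℝ, (K : ℝ) - 1 ≤ b → b ≤ K + m → 2 * b ≤ n → |nodeProd n b| ≤ Z by
    obtain ⟨m, hm⟩ := exists_nat_ge (b - K)
    exact H m b hb (by linarith) hbn
  intro m
  induction m with
  | zero => exact fun b hb hbm _ => hZ b hb (by simpa using hbm)
  | succ m ih =>
    intro b hb hbm hbn
    push_cast at hbm
    rcases le_total b K with h | h
    · exact hZ b hb h
    · have h1 := abs_nodeProd_add_one_le (n := n) (b := b - 1) (by linarith) (by linarith)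
      rw [sub_add_cancel] at h1
      exact h1.trans (ih _ (by linarith) (by linarith) (by linarith))

/-- If all factors with index below `K` are controlled, moving from `a` to `b > a` gains a factor
of order `n ^ (a - b)`. -/
theorem abs_nodeProd_le_rpow {K n : ℕ} (hK : 1 ≤ K) (hKn : K ≤ n) {a b : ℝ} (ha : 0 ≤ a)
    (hab : a ≤ b) (hbK : b ≤ K) (haK : nodeProd K a ≠ 0) :
    |nodeProd n b| ≤
      (K : ℝ) ^ K / |nodeProd K a| * |nodeProd n a| * ((K : ℝ) / n) ^ (b - a) := by
  have hK' : (1 : ℝ) ≤ K := by exact_mod_cast hK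
  induction n, hKn using Nat.le_induction with
  | base =>
    rw [div_self (by positivity), Real.one_rpow, mul_one, div_mul_cancel₀ _ (by simpa using haK)]
    unfold nodeProd
    rw [Finset.abs_prod]
    refine (Finset.prod_le_prod (fun _ _ => abs_nonneg _) (g := fun _ => (K : ℝ)) ?_).trans_eq
      (by simp)
    intro i hi
    have hi' : (i : ℝ) ≤ K := by exact_mod_cast (Finset.mem_range.mp hi).le
    have hi0 : (0 : ℝ) ≤ i := i.cast_nonneg
    rw [abs_le]
    constructor <;> linarith
  | succ n hKn ih =>
    have hKn' : (K : ℝ) ≤ n := by exact_mod_cast hKn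
    have hn : (0 : ℝ) < n := by linarith
    have hstep : (n : ℝ) - b ≤ (n - a) * ((n : ℝ) / (n + 1)) ^ (b - a) := by
      have h1 : (n : ℝ) - b ≤ (n - a) * (1 - (b - a) / n) := by
        have : (n - a) * ((b - a) / n) ≤ b - a := by
          rw [mul_div_assoc', div_le_iff₀ hn]
          nlinarith
        linarith
      refine h1.trans (mul_le_mul_of_nonneg_left ?_ (by linarith))
      have h2 : 1 - (b - a) / n ≤ Real.exp (-((b - a) / n)) := by
        have := Real.add_one_le_exp (-((b - a) / n))
        linarith
      refine h2.trans ?_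
      have h3 : Real.exp (-(1 / (n : ℝ))) ≤ n / (n + 1) := by
        rw [Real.exp_neg, ← inv_div ((n : ℝ) + 1) n]
        refine inv_anti₀ (by positivity) ?_
        have := Real.add_one_le_exp (1 / (n : ℝ))
        rw [add_div, div_self hn.ne']
        linarith
      calc Real.exp (-((b - a) / n)) = Real.exp (-(1 / (n : ℝ))) ^ (b - a) := by
            rw [← Real.exp_mul]
            congr 1
            ring
        _ ≤ _ := Real.rpow_le_rpow (Real.exp_pos _).le h3 (by linarith)
    rw [nodeProd_succ, nodeProd_succ, abs_mul, abs_mul, abs_of_nonneg (by linarith : 0 ≤ (n : ℝ) - b),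
      abs_of_nonneg (by linarith : 0 ≤ (n : ℝ) - a)]
    calc |nodeProd n b| * (n - b)
        ≤ ((K : ℝ) ^ K / |nodeProd K a| * |nodeProd n a| * ((K : ℝ) / n) ^ (b - a)) *
          ((n - a) * ((n : ℝ) / (n + 1)) ^ (b - a)) :=
          mul_le_mul ih hstep (by linarith) (by positivity)
      _ = (K : ℝ) ^ K / |nodeProd K a| * (|nodeProd n a| * (n - a)) *
          (((K : ℝ) / n) ^ (b - a) * ((n : ℝ) / (n + 1)) ^ (b - a)) := by ring
      _ = _ := by
        rw [← Real.mul_rpow (by positivity) (by positivity), div_mul_div_cancel₀ hn.ne']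
        push_cast
        rfl

theorem nodeProd_ne_zero {k : ℕ} {b : ℝ} (hb : (k : ℝ) - 1 < b) (hbk : b < k) (n : ℕ) :
    nodeProd n b ≠ 0 := by
  unfold nodeProd
  refine Finset.prod_ne_zero_iff.mpr fun i _ h => ?_
  have h1 : (i : ℝ) = b := by linarith
  rw [← h1] at hb hbk
  have h2 : (k : ℝ) < i + 1 := by linarith
  have h3 : k < i + 1 := by exact_mod_cast h2
  have h4 : i < k := by exact_mod_cast hbk
  omega

theorem nodeProd_neg_of_odd {k n : ℕ} (hk : Odd k) (hkn : k ≤ n) {b : ℝ} (hb : (k : ℝ) - 1 < b)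
    (hbk : b < k) : nodeProd n b < 0 := by
  induction n, hkn using Nat.le_induction with
  | base =>
    have h : nodeProd k b = -∏ i ∈ Finset.range k, (b - (i : ℝ)) := by
      have h' := Finset.prod_neg (s := Finset.range k) (f := fun i : ℕ => b - (i : ℝ))
      rw [Finset.card_range, hk.neg_one_pow, neg_one_mul] at h'
      rw [← h']
      exact Finset.prod_congr rfl fun _ _ => by ring
    rw [h, neg_lt_zero]
    refine Finset.prod_pos fun i hi => ?_
    have : (i : ℝ) + 1 ≤ k := by exact_mod_cast Finset.mem_range.mp hi
    linarith
  | succ n hkn ih =>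
    have : (k : ℝ) ≤ n := by exact_mod_cast hkn
    rw [nodeProd_succ]
    exact mul_neg_of_neg_of_pos ih (by linarith)

theorem mul_abs_nodeProd_le {k n : ℕ} (hkn : k ≤ n) {a b η : ℝ} (hη : 0 < η)
    (hb : (k : ℝ) - 1 + η ≤ b) (hba : b ≤ a) (hak : a ≤ k) :
    (η / k) ^ k * |nodeProd n a| ≤ |nodeProd n b| := by
  induction n, hkn using Nat.le_induction with
  | base =>
    unfold nodeProd
    rw [Finset.abs_prod, Finset.abs_prod, ← Finset.card_range k, ← Finset.prod_const,
      Finset.card_range, ← Finset.prod_mul_distrib]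
    refine Finset.prod_le_prod (fun _ _ => by positivity) fun i hi => ?_
    have hi' : (i : ℝ) + 1 ≤ k := by exact_mod_cast Finset.mem_range.mp hi
    have hi0 : (0 : ℝ) ≤ i := i.cast_nonneg
    have h1 : |(i : ℝ) - a| ≤ k := abs_le.mpr ⟨by linarith, by linarith⟩
    calc η / k * |(i : ℝ) - a| ≤ η / k * k := mul_le_mul_of_nonneg_left h1 (by positivity)
      _ = η := div_mul_cancel₀ _ (by linarith)
      _ ≤ b - i := by linarith
      _ ≤ _ := by rw [abs_sub_comm]; exact le_abs_self _
  | succ n hkn ih =>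
    have hn : (k : ℝ) ≤ n := by exact_mod_cast hkn
    rw [nodeProd_succ, nodeProd_succ, abs_mul, abs_mul, ← mul_assoc]
    refine mul_le_mul ih ?_ (abs_nonneg _) (abs_nonneg _)
    rw [abs_of_nonneg (by linarith), abs_of_nonneg (by linarith)]
    linarith

/-- Integrating by parts `j` times against `(1 - x²) ^ (d + j) G`. -/
theorem exists_integral_iterate_derivative_eq (d j : ℕ) (G : Polynomial ℝ) (hG : 0 < G.eval 1) :
    ∃ H : Polynomial ℝ, 0 < H.eval 1 ∧ ∀ Q : Polynomial ℝ,
      ∫ x in (-1 : ℝ)..1, (1 - x ^ 2) ^ (d + j) * G.eval x * (Polynomial.derivative^[j] Q).eval x =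
        ∫ x in (-1 : ℝ)..1, (1 - x ^ 2) ^ d * H.eval x * Q.eval x := by
  induction j generalizing G with
  | zero => exact ⟨G, hG, fun Q => rfl⟩
  | succ j ih =>
    obtain ⟨H, hH, hHQ⟩ := ih (Polynomial.C (2 * ((d : ℝ) + j + 1)) * Polynomial.X * G -
      (1 - Polynomial.X ^ 2) * Polynomial.derivative G) (by simp; positivity)
    refine ⟨H, hH, fun Q => ?_⟩
    rw [← hHQ Q]
    set P := Polynomial.derivative^[j] Q with hP
    set U : Polynomial ℝ := (1 - Polynomial.X ^ 2) ^ (d + j + 1) * G with hU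
    have hparts := intervalIntegral.integral_mul_deriv_eq_deriv_mul (a := -1) (b := 1)
      (fun x _ => U.hasDerivAt x) (fun x _ => P.hasDerivAt x)
      ((Polynomial.continuous _).intervalIntegrable _ _)
      ((Polynomial.continuous _).intervalIntegrable _ _)
    have h1 : U.eval 1 = 0 := by simp [hU]
    have h2 : U.eval (-1) = 0 := by simp [hU]
    rw [h1, h2, zero_mul, zero_mul, sub_zero, zero_sub, ← intervalIntegral.integral_neg] at hparts
    rw [Function.iterate_succ_apply', ← hP]
    calc _ = ∫ x in (-1 : ℝ)..1, U.eval x * P.derivative.eval x :=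
          intervalIntegral.integral_congr fun x _ => by simp [hU, add_assoc]
      _ = _ := hparts
      _ = _ := intervalIntegral.integral_congr fun x _ => by
          simp [hU, Polynomial.derivative_mul, Polynomial.derivative_pow]
          ring

theorem iteratedDeriv_eval (p : Polynomial ℝ) (j : ℕ) :
    iteratedDeriv j (fun x => p.eval x) = fun x => (Polynomial.derivative^[j] p).eval x := by
  induction j with
  | zero => simp
  | succ j ih =>
    rw [iteratedDeriv_succ, ih, Function.iterate_succ_apply']
    ext x
    exact Polynomial.deriv _

theorem integral_le_const_mul {f : ℝ → ℝ} (hf : Continuous f) {a b C : ℝ} (hab : a ≤ b)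
    (h : ∀ x, a ≤ x → x ≤ b → f x ≤ C) : ∫ x in a..b, f x ≤ C * (b - a) := by
  have h1 := intervalIntegral.integral_mono_on hab (hf.intervalIntegrable (μ := volume) a b)
    (continuous_const.intervalIntegrable a b) fun x hx => h x hx.1 hx.2
  rwa [intervalIntegral.integral_const, smul_eq_mul, mul_comm] at h1

theorem integral_le_of_piecewise_bounds {f : ℝ → ℝ} (hf : Continuous f)
    {x₀ x₁ x₂ x₃ x₄ x₅ x₆ m E E' : ℝ} (h₁ : x₀ ≤ x₁) (h₂ : x₁ ≤ x₂) (h₃ : x₂ ≤ x₃) (h₄ : x₃ ≤ x₄)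
    (h₅ : x₄ ≤ x₅) (h₆ : x₅ ≤ x₆) (hnonpos : ∀ x, x₀ ≤ x → x ≤ x₃ → f x ≤ 0)
    (hneg : ∀ x, x₁ ≤ x → x ≤ x₂ → f x ≤ -m) (hleft : ∀ x, x₃ ≤ x → x ≤ x₄ → f x ≤ E)
    (hmid : ∀ x, x₄ ≤ x → x ≤ x₅ → f x ≤ E') (hright : ∀ x, x₅ ≤ x → x ≤ x₆ → f x ≤ E) :
    ∫ x in x₀..x₆, f x ≤ E * (x₄ - x₃) + E' * (x₅ - x₄) + E * (x₆ - x₅) - m * (x₂ - x₁) := by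
  have hi := fun x y => hf.intervalIntegrable (μ := volume) x y
  rw [← intervalIntegral.integral_add_adjacent_intervals (hi x₀ x₁) (hi x₁ x₆),
    ← intervalIntegral.integral_add_adjacent_intervals (hi x₁ x₂) (hi x₂ x₆),
    ← intervalIntegral.integral_add_adjacent_intervals (hi x₂ x₃) (hi x₃ x₆),
    ← intervalIntegral.integral_add_adjacent_intervals (hi x₃ x₄) (hi x₄ x₆),
    ← intervalIntegral.integral_add_adjacent_intervals (hi x₄ x₅) (hi x₅ x₆)]
  have e₁ := integral_le_const_mul hf h₁ fun x hx hx' => hnonpos x hx (by linarith)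
  have e₂ := integral_le_const_mul hf h₂ hneg
  have e₃ := integral_le_const_mul hf h₃ fun x hx hx' => hnonpos x (by linarith) hx'
  have e₄ := integral_le_const_mul hf h₄ hleft
  have e₅ := integral_le_const_mul hf h₅ hmid
  have e₆ := integral_le_const_mul hf h₆ hright
  linarith

/-- Relative to its value at `a`, `nodeProd n` is small on `[a + δ, K]`, and smaller than
`n ^ (-(d + 1))` on `[K - 1, n / 2]`. -/
theorem exists_nodeProd_decay (d : ℕ) {a δ : ℝ} (L : ℝ) (ha : 0 ≤ a) (hδ : 0 < δ)
    (hne : ∀ n, nodeProd n a ≠ 0) :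
    ∃ K : ℕ, L ≤ K ∧ ∃ ε : ℕ → ℝ, Tendsto ε atTop (𝓝 0) ∧ ∀ᶠ n : ℕ in atTop,
      (∀ b, a + δ ≤ b → b ≤ K → |nodeProd n b| ≤ ε n * |nodeProd n a|) ∧
      ∀ b, (K : ℝ) - 1 ≤ b → 2 * b ≤ n →
        (n : ℝ) ^ (d + 1) * |nodeProd n b| ≤ ε n * |nodeProd n a| := by
  obtain ⟨K, hK⟩ := exists_nat_ge (max L (a + d + 3))
  have hKL := (le_max_left _ _).trans hK
  have hKd := (le_max_right _ _).trans hK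
  have hd : (0 : ℝ) ≤ d := d.cast_nonneg
  have hK1 : 1 ≤ K := by
    have : (1 : ℝ) ≤ K := by linarith
    exact_mod_cast this
  have hK0 : (0 : ℝ) < K := by linarith
  set C := (K : ℝ) ^ K / |nodeProd K a| with hC
  have hC0 : 0 ≤ C := by positivity
  refine ⟨K, hKL, fun n => C * (((K : ℝ) / n) ^ δ + (K : ℝ) ^ (d + 2) / n), ?_, ?_⟩
  · have h1 : Tendsto (fun n : ℕ => (K : ℝ) / n) atTop (𝓝 0) :=
      tendsto_const_div_atTop_nhds_zero_nat _
    have h2 := h1.rpow_const (p := δ) (Or.inr hδ.le)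
    rw [Real.zero_rpow hδ.ne'] at h2
    have h3 := (h2.add (tendsto_const_div_atTop_nhds_zero_nat ((K : ℝ) ^ (d + 2)))).const_mul C
    simpa using h3
  filter_upwards [eventually_ge_atTop K] with n hn
  have hn' : (K : ℝ) ≤ n := by exact_mod_cast hn
  have hn0 : (0 : ℝ) < n := by linarith
  have hq0 : 0 < (K : ℝ) / n := by positivity
  have hq1 : (K : ℝ) / n ≤ 1 := (div_le_one hn0).mpr hn'
  have hmain : ∀ {b e : ℝ}, a ≤ b → b ≤ K → e ≤ b - a →
      |nodeProd n b| ≤ C * |nodeProd n a| * ((K : ℝ) / n) ^ e := fun hb hbK he =>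
    (abs_nodeProd_le_rpow hK1 hn ha hb hbK (hne K)).trans
      (mul_le_mul_of_nonneg_left (Real.rpow_le_rpow_of_exponent_ge hq0 hq1 he) (by positivity))
  constructor
  · intro b hb hbK
    have h1 : 0 ≤ C * |nodeProd n a| * ((K : ℝ) ^ (d + 2) / n) := by positivity
    have h2 := hmain (b := b) (e := δ) (by linarith) hbK (by linarith)
    linarith
  · intro b hb hbn
    have h1 : |nodeProd n b| ≤ C * |nodeProd n a| * ((K : ℝ) / n) ^ (d + 2) := by
      refine abs_nodeProd_le_of_le_half hK1 (fun c hc hcK => ?_) hb hbn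
      have := hmain (b := c) (e := ((d + 2 : ℕ) : ℝ)) (by linarith) hcK (by push_cast; linarith)
      rwa [Real.rpow_natCast] at this
    calc (n : ℝ) ^ (d + 1) * |nodeProd n b|
        ≤ (n : ℝ) ^ (d + 1) * (C * |nodeProd n a| * ((K : ℝ) / n) ^ (d + 2)) :=
          mul_le_mul_of_nonneg_left h1 (by positivity)
      _ = C * ((K : ℝ) ^ (d + 2) / n) * |nodeProd n a| := by
          rw [div_pow]
          field_simp
          ring
      _ ≤ _ := by
          have h2 : 0 ≤ C * |nodeProd n a| * ((K : ℝ) / n) ^ δ := by positivity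
          linarith

theorem mul_div_pow_mul_mul_le (d : ℕ) {s t N w y M : ℝ} (hs : 0 ≤ s) (ht : 0 ≤ t) (hN : 0 < N)
    (hst : s + t = N) (hw : s ≤ w ∨ t ≤ w) (hy : |y| ≤ M) (p : ℝ) :
    (s * t / N) ^ d * y * p ≤ w ^ d * M * |p| := by
  have h0 : 0 ≤ s * t / N := by positivity
  have h1 : s * t / N ≤ w := by
    rw [div_le_iff₀ hN]
    rcases hw with hw | hw
    · exact mul_le_mul hw (by linarith) ht (hs.trans hw)
    · rw [mul_comm s]
      exact mul_le_mul hw (by linarith) hs (ht.trans hw)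
  refine (le_abs_self _).trans ?_
  rw [abs_mul, abs_mul, abs_of_nonneg (pow_nonneg h0 d)]
  exact mul_le_mul_of_nonneg_right (mul_le_mul (pow_le_pow_left₀ h0 h1 d) hy (abs_nonneg _)
    (pow_nonneg (h0.trans h1) _)) (abs_nonneg _)

set_option maxHeartbeats 1000000 in
theorem eventually_integral_nodeProd_neg (d : ℕ) {k : ℕ} (hk : Odd k) {β γ : ℝ}
    (hβ : (k : ℝ) - 1 < β) (hβk : β < k) (hγ : β < γ) {g : ℝ → ℝ} (hg : Continuous g)
    (hg1 : 0 < g 1) :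
    ∀ᶠ n : ℕ in atTop, ∫ b in β..(n - 1 - γ),
      ((b - β) * (n - 1 - γ - b) / (n - 1 - γ - β)) ^ d *
        g (1 - 2 * (b - β) / (n - 1 - γ - β)) * nodeProd n b < 0 := by
  have hk1 : (1 : ℝ) ≤ k := by exact_mod_cast hk.pos
  obtain ⟨δ, hδ, hδk, hδγ⟩ : ∃ δ : ℝ, 0 < δ ∧ β + δ < k ∧ β + δ ≤ γ := by
    refine ⟨min (k - β) (γ - β) / 2, ?_, ?_, ?_⟩
    · exact half_pos (lt_min (by linarith) (by linarith))
    · linarith [min_le_left (k - β) (γ - β)]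
    · linarith [min_le_right (k - β) (γ - β)]
  obtain ⟨a, rfl⟩ : ∃ a, β = a - δ / 2 := ⟨β + δ / 2, by ring⟩
  obtain ⟨K, hK, ε, hε, hdecay⟩ := exists_nodeProd_decay d (δ := δ / 2) (max γ (a + δ))
    (by linarith : 0 ≤ a) (by linarith) fun n =>
      nodeProd_ne_zero (k := k) (by linarith) (by linarith) n
  have hKγ := (le_max_left _ _).trans hK
  have hKa := (le_max_right _ _).trans hK
  obtain ⟨M, hM⟩ := isCompact_Icc.exists_bound_of_continuousOn (s := Set.Icc (-1 : ℝ) 1)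
    hg.continuousOn
  simp only [Set.mem_Icc, Real.norm_eq_abs] at hM
  have hM0 : 0 ≤ M := (abs_nonneg _).trans (hM 0 (by norm_num))
  obtain ⟨ρ, hρ, hgρ⟩ : ∃ ρ > 0, ∀ x, |x - 1| < ρ → g 1 / 2 < g x :=
    Metric.eventually_nhds_iff.mp (hg.continuousAt.eventually_const_lt (by linarith))
  set c := (δ / 8) ^ d * (g 1 / 2) * (δ / 4 / k) ^ k with hc
  have hc0 : 0 < c := by positivity
  set A := 2 * (K : ℝ) ^ d * M * K + M with hA
  have hsmall : ∀ᶠ n in atTop, ε n * A < c * (δ / 4) :=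
    (by simpa using hε.mul_const A : Tendsto (fun n => ε n * A) atTop (𝓝 0)).eventually_lt_const
      (by positivity)
  obtain ⟨n₀, hn₀⟩ := exists_nat_ge (1 + γ + a + 2 * δ + 2 * δ / ρ + 3 * K + k + 1)
  filter_upwards [hdecay, hsmall, eventually_ge_atTop n₀] with n hdn hsn hn
  obtain ⟨hnear, hfar⟩ := hdn
  have hn' : (n₀ : ℝ) ≤ n := by exact_mod_cast hn
  have hδρ : 0 < 2 * δ / ρ := by positivity
  have hkn : k ≤ n := by
    have : (k : ℝ) ≤ n := by linarith
    exact_mod_cast this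
  set N := (n : ℝ) - 1 - γ - (a - δ / 2) with hN
  have hN1 : 2 * δ / ρ < N := by linarith
  have hN2 : 2 * δ < N := by linarith
  have hN0 : 0 < N := by linarith
  have hR : 0 < |nodeProd n a| :=
    abs_pos.mpr (nodeProd_ne_zero (k := k) (by linarith) (by linarith) n)
  set R := |nodeProd n a|
  set f : ℝ → ℝ := fun b => ((b - (a - δ / 2)) * (n - 1 - γ - b) / N) ^ d *
    g (1 - 2 * (b - (a - δ / 2)) / N) * nodeProd n b with hf
  have hfc : Continuous f := by
    have := continuous_nodeProd n
    fun_prop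
  have hgs : ∀ s, 0 ≤ s → s ≤ δ → g 1 / 2 < g (1 - 2 * s / N) := by
    intro s hs hsδ
    refine hgρ _ ?_
    rw [show 1 - 2 * s / N - 1 = -(2 * s / N) by ring, abs_neg, abs_of_nonneg (by positivity),
      div_lt_iff₀ hN0]
    rw [div_lt_iff₀ hρ] at hN1
    linarith
  have hnonpos : ∀ b, a - δ / 2 ≤ b → b ≤ a + δ / 2 → f b ≤ 0 := by
    intro b hb hb'
    refine mul_nonpos_of_nonneg_of_nonpos (mul_nonneg (pow_nonneg (div_nonneg (mul_nonneg
      (by linarith) (by linarith)) hN0.le) _) ?_)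
      (nodeProd_neg_of_odd hk hkn (by linarith) (by linarith)).le
    linarith [hgs (b - (a - δ / 2)) (by linarith) (by linarith)]
  have hneg : ∀ b, a - δ / 4 ≤ b → b ≤ a → f b ≤ -(c * R) := by
    intro b hb hb'
    have h1 := nodeProd_neg_of_odd (n := n) (b := b) hk hkn (by linarith) (by linarith)
    have h2 := mul_abs_nodeProd_le (a := a) (b := b) (η := δ / 4) hkn (by positivity)
      (by linarith) hb' (by linarith)
    rw [abs_of_neg h1] at h2
    have h3 := hgs (b - (a - δ / 2)) (by linarith) (by linarith)
    have h4 : δ / 8 ≤ (b - (a - δ / 2)) * (n - 1 - γ - b) / N := by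
      rw [le_div_iff₀ hN0]
      nlinarith
    have h5 := pow_le_pow_left₀ (by positivity) h4 d
    have h6 := mul_le_mul (mul_le_mul h5 h3.le (by positivity) (le_trans (by positivity) h5)) h2
      (by positivity) (mul_nonneg (le_trans (by positivity) h5) (by linarith))
    simp only [hf, hc]
    linarith
  have habs : ∀ b w, a - δ / 2 ≤ b → b ≤ n - 1 - γ →
      (b - (a - δ / 2) ≤ w ∨ n - 1 - γ - b ≤ w) → f b ≤ w ^ d * M * |nodeProd n b| := by
    intro b w hb hb' hw
    have h2 : |g (1 - 2 * (b - (a - δ / 2)) / N)| ≤ M := by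
      refine hM _ ⟨?_, ?_⟩
      · have : 2 * (b - (a - δ / 2)) / N ≤ 2 := by
          rw [div_le_iff₀ hN0]
          linarith
        linarith
      · have : 0 ≤ 2 * (b - (a - δ / 2)) / N := div_nonneg (by linarith) hN0.le
        linarith
    exact mul_div_pow_mul_mul_le d (by linarith) (by linarith) hN0 (by linarith) hw h2 _
  have hKM : 0 ≤ (K : ℝ) ^ d * M := by positivity
  have hleft : ∀ b, a + δ / 2 ≤ b → b ≤ K → f b ≤ (K : ℝ) ^ d * M * (ε n * R) := fun b hb hb' =>
    (habs b K (by linarith) (by linarith) (Or.inl (by linarith))).trans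
      (mul_le_mul_of_nonneg_left (hnear b hb hb') hKM)
  have hright : ∀ b, (n : ℝ) - 1 - K ≤ b → b ≤ n - 1 - γ →
      f b ≤ (K : ℝ) ^ d * M * (ε n * R) := by
    intro b hb hb'
    refine (habs b K (by linarith) hb' (Or.inr (by linarith))).trans
      (mul_le_mul_of_nonneg_left ?_ hKM)
    rw [← abs_nodeProd_reflect]
    exact hnear _ (by linarith) (by linarith)
  have hn0 : (0 : ℝ) < n := by linarith
  have hmid : ∀ b, (K : ℝ) ≤ b → b ≤ n - 1 - K → f b ≤ M * (ε n * R) / n := by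
    intro b hb hb'
    refine (habs b n (by linarith) (by linarith) (Or.inl (by linarith))).trans ?_
    have h1 : (n : ℝ) ^ (d + 1) * |nodeProd n b| ≤ ε n * R := by
      rcases le_total (2 * b) n with h | h
      · exact hfar b (by linarith) h
      · rw [← abs_nodeProd_reflect]
        exact hfar _ (by linarith) (by linarith)
    rw [le_div_iff₀ hn0]
    calc _ = M * ((n : ℝ) ^ (d + 1) * |nodeProd n b|) := by ring
      _ ≤ _ := mul_le_mul_of_nonneg_left h1 hM0
  have hεR : 0 ≤ ε n * R := (abs_nonneg _).trans (hnear (a + δ / 2) le_rfl (by linarith))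
  refine (integral_le_of_piecewise_bounds hfc (by linarith) (by linarith) (by linarith)
    (by linarith) (by linarith) (by linarith) hnonpos hneg hleft hmid hright).trans_lt ?_
  have hE : 0 ≤ (K : ℝ) ^ d * M * (ε n * R) := mul_nonneg hKM hεR
  have hE' : 0 ≤ M * (ε n * R) / n := div_nonneg (mul_nonneg hM0 hεR) hn0.le
  calc _ ≤ (K : ℝ) ^ d * M * (ε n * R) * K + M * (ε n * R) / n * n +
        (K : ℝ) ^ d * M * (ε n * R) * K - c * R * (a - (a - δ / 4)) := by
        gcongr <;> linarith
    _ = (ε n * A - c * (δ / 4)) * R := by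
        rw [div_mul_cancel₀ _ hn0.ne', hA]
        ring
    _ < 0 := mul_neg_of_neg_of_pos (by linarith) hR

theorem integral_risingFactorial_eq (d n : ℕ) (r μ : ℝ) (hN : 0 < (n : ℝ) - 3 * μ) (g : ℝ → ℝ) :
    ∃ c > 0, ∫ x in (-1 : ℝ)..1, (1 - x ^ 2) ^ d * g x *
        risingFactorial (((n : ℝ) - 3 * μ) * x / 2 + (μ - (n : ℝ)) / 2 + r + 1) n =
      c * ∫ b in (μ - r - 1)..(n - 1 - (2 * μ + r)),
        ((b - (μ - r - 1)) * (n - 1 - (2 * μ + r) - b) / (n - 1 - (2 * μ + r) - (μ - r - 1))) ^ d *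
          g (1 - 2 * (b - (μ - r - 1)) / (n - 1 - (2 * μ + r) - (μ - r - 1))) * nodeProd n b := by
  set N := (n : ℝ) - 3 * μ with hNdef
  have hN' : (n : ℝ) - 1 - (2 * μ + r) - (μ - r - 1) = N := by ring
  have hsub := intervalIntegral.integral_comp_sub_mul (a := μ - r - 1)
    (b := n - 1 - (2 * μ + r)) (fun x : ℝ => (1 - x ^ 2) ^ d * g x *
      risingFactorial (N * x / 2 + (μ - (n : ℝ)) / 2 + r + 1) n)
    (c := 2 / N) (by positivity) (1 + 2 / N * (μ - r - 1))
  have hl : 1 + 2 / N * (μ - r - 1) - 2 / N * (n - 1 - (2 * μ + r)) = -1 := by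
    rw [show (n : ℝ) - 1 - (2 * μ + r) = N + (μ - r - 1) by rw [← hN']; ring]
    field_simp
    ring
  rw [hl, add_sub_cancel_right, smul_eq_mul] at hsub
  refine ⟨2 / N * (4 / N) ^ d, by positivity, ?_⟩
  rw [mul_assoc, ← intervalIntegral.integral_const_mul, hN']
  have h2 : (2 / N) * (2 / N)⁻¹ = 1 := mul_inv_cancel₀ (by positivity)
  calc _ = 2 / N * ((2 / N)⁻¹ * ∫ x in (-1 : ℝ)..1, (1 - x ^ 2) ^ d * g x *
        risingFactorial (N * x / 2 + (μ - (n : ℝ)) / 2 + r + 1) n) := by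
        rw [← mul_assoc, h2, one_mul]
    _ = _ := by rw [← hsub]
    _ = _ := ?_
  congr 1
  refine intervalIntegral.integral_congr fun b _ => ?_
  have hx : 1 + 2 / N * (μ - r - 1) - 2 / N * b = 1 - 2 * (b - (μ - r - 1)) / N := by ring
  have hw : 1 - (1 - 2 * (b - (μ - r - 1)) / N) ^ 2 =
      4 / N * ((b - (μ - r - 1)) * (n - 1 - (2 * μ + r) - b) / N) := by
    rw [show (n : ℝ) - 1 - (2 * μ + r) = N + (μ - r - 1) by rw [← hN']; ring]
    field_simp
    ring
  have hy : N * (1 - 2 * (b - (μ - r - 1)) / N) / 2 + (μ - n) / 2 + r + 1 = -b := by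
    field_simp
    rw [hNdef]
    ring
  simp only [hx, hw, hy, risingFactorial_neg, mul_pow]
  ring

theorem exists_polynomial_eval_eq_risingFactorial (u v : ℝ) (n : ℕ) :
    ∃ Q : Polynomial ℝ, ∀ x, Q.eval x = risingFactorial (u * x / 2 + v) n := by
  refine ⟨∏ i ∈ Finset.range n,
    (Polynomial.C (u / 2) * Polynomial.X + Polynomial.C (v + i)), fun x => ?_⟩
  rw [Polynomial.eval_prod, risingFactorial]
  refine Finset.prod_congr rfl fun i _ => ?_
  simp
  ring

/-- Consequence of Theorem 9 (fixed-spin large-`n` asymptotics), negative case: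
the coefficients are eventually strictly negative. -/
theorem fixed_spin_asymptotics_negative (j : ℕ) (D : ℤ) (hD : 4 ≤ D) (hDeven : Even D)
    (r μ : ℝ) (hr : -1 < r) (h1 : 0 < 2 * r + μ + 1)
    (hk : ∃ k : ℕ, Odd k ∧ 1 ≤ k ∧ (k : ℝ) < μ - r ∧ μ - r < (k : ℝ) + 1) :
    ∃ N : ℕ, ∀ n : ℕ, N ≤ n → B 1 n j r μ (D : ℝ) < 0 := by
  obtain ⟨k, hk_odd, -, hkl, hku⟩ := hk
  obtain ⟨d, rfl⟩ : ∃ d : ℕ, D = 2 * d + 4 := by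
    obtain ⟨m, rfl⟩ := hDeven
    exact ⟨(m - 2).toNat, by omega⟩
  obtain ⟨H, hH, hHQ⟩ := exists_integral_iterate_derivative_eq d j 1 (by simp)
  have hneg := eventually_integral_nodeProd_neg d hk_odd (β := μ - r - 1) (γ := 2 * μ + r)
    (by linarith) (by linarith) (by linarith) H.continuous hH
  obtain ⟨n₁, hn₁⟩ := exists_nat_gt (3 * μ)
  refine eventually_atTop.mp ?_
  filter_upwards [hneg, eventually_ge_atTop n₁, eventually_ge_atTop 1] with n hn hnn₁ hn1
  have hN : 0 < (n : ℝ) - 3 * μ := by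
    have : (n₁ : ℝ) ≤ n := by exact_mod_cast hnn₁
    linarith
  have hpos : 0 < risingFactorial (r + 1) n :=
    Finset.prod_pos fun i _ => by
      have : (0 : ℝ) ≤ i := i.cast_nonneg
      linarith
  obtain ⟨Q, hQ⟩ := exists_polynomial_eval_eq_risingFactorial ((n : ℝ) - 3 * μ)
    ((μ - n) / 2 + r + 1) n
  have hQ' : ∀ x : ℝ, risingFactorial (((n : ℝ) - 3 * μ) * x / 2 + (μ - (n : ℝ)) / 2 + r + 1) n =
      Q.eval x := fun x => by rw [hQ x]; congr 1; ring
  obtain ⟨c, hc, hceq⟩ := integral_risingFactorial_eq d n r μ hN fun x => H.eval x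
  have hexp : (((2 * d + 4 : ℤ) : ℝ) - 4) / 2 + (j : ℝ) = ((d + j : ℕ) : ℝ) := by
    push_cast
    ring
  have hI := hHQ Q
  simp only [hQ', Polynomial.eval_one, mul_one] at hceq hI
  unfold B
  simp only [Nat.sub_add_cancel hn1, hQ', hexp, Real.rpow_natCast, iteratedDeriv_eval]
  rw [hI, hceq]
  exact mul_neg_of_pos_of_neg (by positivity) (mul_neg_of_pos_of_neg hc hn)
end

section
/- Positivity and growth of the Laurent coefficients a_k(p,q) (Lemma 1 of the Appendix). Let p be real and q ≥ 1 a natural number, and suppose one of the following holds: (i) q = 1 and p ≤ -1/√6; (ii) q = 2 and p ≤ (-3-√3)/6; (iii) q ≥ 3 and p ≤ (1-q)/2. Then for every integer k ≥ -q+2 one has a_k(p,q) ≥ 0 and 2·a_{k+1}(p,q) ≥ a_k(p,q). -/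
/-- The function `z ↦ (1-z)^p · z^q / (-log(1-z))^q`, extended by its limiting value `1`
at `z = 0`; it is real-analytic at `0`. -/
noncomputable def h (p : ℝ) (q : ℕ) : ℝ → ℝ := fun z =>
  if z = 0 then 1 else (1 - z) ^ p * z ^ q / (-Real.log (1 - z)) ^ q

/-- The Laurent coefficient `a_k(p,q)` of `(1-z)^p / (-log(1-z))^q` about `z = 0`,
for integers `k ≥ -q`. -/
noncomputable def a (k : ℤ) (p : ℝ) (q : ℕ) : ℝ :=
  iteratedDeriv (k + q).toNat (h p q) 0 / (((k + q).toNat).factorial : ℝ)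

open MeasureTheory intervalIntegral

/-- The `q`-fold moving average of `f` over windows of unit length. -/
noncomputable def movingAvg : ℕ → (ℝ → ℝ) → ℝ → ℝ
  | 0, f, y => f y
  | q + 1, f, y => ∫ s in (-1 / 2 : ℝ)..(1 / 2), movingAvg q f (y + s)

namespace movingAvg

theorem continuous (q : ℕ) {f : ℝ → ℝ} (hf : Continuous f) : Continuous (movingAvg q f) := by
  induction q with
  | zero => exact hf
  | succ q ih =>
    exact continuous_parametric_intervalIntegral_of_continuous'
      (f := fun y s => movingAvg q f (y + s)) (by fun_prop) _ _

theorem intervalIntegrable (q : ℕ) {f : ℝ → ℝ} (hf : Continuous f) (y a b : ℝ) :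
    IntervalIntegrable (fun s => movingAvg q f (y + s)) volume a b :=
  ((continuous q hf).comp (continuous_const.add continuous_id)).intervalIntegrable a b

theorem mono (q : ℕ) {f g : ℝ → ℝ} (hf : Continuous f) (hg : Continuous g)
    (hfg : ∀ x, f x ≤ g x) (y : ℝ) : movingAvg q f y ≤ movingAvg q g y := by
  induction q generalizing y with
  | zero => exact hfg y
  | succ q ih =>
    exact integral_mono_on (by norm_num) (intervalIntegrable q hf y _ _)
      (intervalIntegrable q hg y _ _) fun s _ => ih (y + s)

theorem add (q : ℕ) {f g : ℝ → ℝ} (hf : Continuous f) (hg : Continuous g) (y : ℝ) :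
    movingAvg q (fun x => f x + g x) y = movingAvg q f y + movingAvg q g y := by
  induction q generalizing y with
  | zero => rfl
  | succ q ih =>
    simp only [movingAvg, ih]
    exact integral_add (intervalIntegrable q hf y _ _) (intervalIntegrable q hg y _ _)

theorem const_mul (q : ℕ) (c : ℝ) (f : ℝ → ℝ) (y : ℝ) :
    movingAvg q (fun x => c * f x) y = c * movingAvg q f y := by
  induction q generalizing y with
  | zero => rfl
  | succ q ih => simp only [movingAvg, ih, intervalIntegral.integral_const_mul]

theorem comp_sub_left (q : ℕ) (f : ℝ → ℝ) (b y : ℝ) :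
    movingAvg q (fun x => f (b - x)) y = movingAvg q f (b - y) := by
  induction q generalizing y with
  | zero => rfl
  | succ q ih =>
    simp only [movingAvg, ih]
    have h1 := integral_comp_neg (a := -1 / 2) (b := 1 / 2) fun s => movingAvg q f (b - y + s)
    rw [neg_div, neg_neg] at h1
    rw [neg_div, ← h1]
    simp only [← sub_eq_add_neg, sub_sub]

theorem sq_sub_add (q : ℕ) (b c y : ℝ) :
    movingAvg q (fun x => (x - b) ^ 2 + c) y = (y - b) ^ 2 + q / 12 + c := by
  induction q generalizing y with
  | zero => simp [movingAvg]
  | succ q ih =>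
    simp only [movingAvg, ih]
    have h1 : ∀ s : ℝ, (y + s - b) ^ 2 + (q : ℝ) / 12 + c =
        s ^ 2 + (2 * (y - b)) * s + ((y - b) ^ 2 + q / 12 + c) := fun s => by ring
    simp only [h1]
    rw [intervalIntegral.integral_add (Continuous.intervalIntegrable (by fun_prop) _ _)
        (Continuous.intervalIntegrable (by fun_prop) _ _),
      intervalIntegral.integral_add (Continuous.intervalIntegrable (by fun_prop) _ _)
        (Continuous.intervalIntegrable (by fun_prop) _ _),
      integral_pow, intervalIntegral.integral_const_mul, integral_id,
      intervalIntegral.integral_const]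
    push_cast
    simp only [smul_eq_mul]
    ring

end movingAvg

/-- The coefficient of `z ^ n` in `(1 - z) ^ x`. -/
noncomputable def binomCoeff (n : ℕ) (x : ℝ) : ℝ :=
  (∏ i ∈ Finset.range n, ((i : ℝ) - x)) / n.factorial

namespace binomCoeff

theorem continuous (n : ℕ) : Continuous (binomCoeff n) := by
  unfold binomCoeff
  fun_prop

theorem eq_choose (n : ℕ) (x : ℝ) : binomCoeff n x = (-1) ^ n * Ring.choose x n := by
  have h1 := Ring.descPochhammer_eq_factorial_smul_choose x n
  have h2 : ∏ i ∈ Finset.range n, ((i : ℝ) - x) = (-1) ^ n * (descPochhammer ℤ n).smeval x := by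
    clear h1
    induction n with
    | zero => simp
    | succ n ih =>
      rw [Finset.prod_range_succ, ih]
      simp [descPochhammer_succ_right, Polynomial.smeval_mul, Polynomial.smeval_natCast]
      ring
  rw [binomCoeff, h2, h1, nsmul_eq_mul]
  field_simp

theorem hasSum (x : ℝ) {z : ℝ} (hz : |z| < 1) :
    HasSum (fun n => binomCoeff n x * z ^ n) ((1 - z) ^ x) := by
  have h1 := (Real.one_add_rpow_hasFPowerSeriesOnBall_zero (a := x)).hasSum (y := -z)
    (by simpa [Metric.mem_eball, edist_dist, Real.dist_eq] using hz)
  rw [zero_add, ← sub_eq_add_neg] at h1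
  simp only [binomialSeries_apply, List.ofFn_const,
    List.prod_replicate, smul_eq_mul] at h1
  refine h1.congr_fun fun n => ?_
  rw [eq_choose, neg_pow z]
  ring

theorem abs_le {n : ℕ} {x b : ℝ} (hx : |x| ≤ b) : |binomCoeff n x| ≤ binomCoeff n (-b) := by
  unfold binomCoeff
  rw [abs_div, Finset.abs_prod, Nat.abs_cast]
  gcongr with i
  have := abs_sub (i : ℝ) x
  rw [Nat.abs_cast] at this
  linarith

theorem two_mul_succ_sub (m : ℕ) (x : ℝ) :
    2 * binomCoeff (m + 3) x - binomCoeff (m + 2) x =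
      ((1 / 2 - x) ^ 2 - 1 / 4) * (1 / ((m + 3).factorial : ℝ) *
        ((∏ i ∈ Finset.range m, ((1 / 2 - x) + (i + 3 / 2))) * (2 * ((1 / 2 - x) + m / 2)))) := by
  have h1 : ∏ i ∈ Finset.range m, ((1 / 2 - x) + ((i : ℝ) + 3 / 2)) =
      ∏ i ∈ Finset.range m, (((i + 1 + 1 : ℕ) : ℝ) - x) := by
    refine Finset.prod_congr rfl fun i _ => ?_
    push_cast
    ring
  rw [h1, binomCoeff, binomCoeff, Finset.prod_range_succ, Finset.prod_range_succ',
    Finset.prod_range_succ', Nat.factorial_succ (m + 2)]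
  push_cast
  field_simp
  ring

theorem abs_movingAvg_le (q n : ℕ) (y : ℝ) :
    |movingAvg q (binomCoeff n) y| ≤ binomCoeff n (-(|y| + q / 2)) := by
  induction q generalizing y with
  | zero => exact abs_le (by simp)
  | succ q ih =>
    have key : ∀ s ∈ Set.uIoc (-1 / 2 : ℝ) (1 / 2),
        ‖movingAvg q (binomCoeff n) (y + s)‖ ≤ binomCoeff n (-(|y| + (q + 1 : ℕ) / 2)) := by
      intro s hs
      rw [Set.uIoc_of_le (by norm_num)] at hs
      refine (ih (y + s)).trans ((le_abs_self _).trans (abs_le ?_))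
      have h1 := abs_add_le y s
      have h2 : |s| ≤ 1 / 2 := _root_.abs_le.2 ⟨by linarith [hs.1], hs.2⟩
      rw [abs_neg, abs_of_nonneg (by positivity)]
      push_cast
      linarith
    have := norm_integral_le_of_norm_le_const key
    rwa [show |(1 / 2 : ℝ) - -1 / 2| = 1 by norm_num, mul_one] at this

end binomCoeff

/-- The even and odd parts of `P` about `δ` are nonnegative and monotone to the right of `δ`. -/
structure SymmMono (δ : ℝ) (P : ℝ → ℝ) : Prop where
  nonneg : 0 ≤ P δ
  even : ∀ ⦃s t : ℝ⦄, 0 ≤ s → s ≤ t → P (δ + s) + P (δ - s) ≤ P (δ + t) + P (δ - t)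
  odd : ∀ ⦃s t : ℝ⦄, 0 ≤ s → s ≤ t → P (δ + s) - P (δ - s) ≤ P (δ + t) - P (δ - t)

namespace SymmMono

variable {δ : ℝ} {P : ℝ → ℝ}

theorem const {c : ℝ} (hc : 0 ≤ c) : SymmMono δ fun _ => c :=
  ⟨hc, fun _ _ _ _ => le_rfl, fun _ _ _ _ => le_rfl⟩

theorem const_mul (hP : SymmMono δ P) {c : ℝ} (hc : 0 ≤ c) : SymmMono δ fun v => c * P v where
  nonneg := mul_nonneg hc hP.nonneg
  even s t hs hst := by
    simpa only [mul_add] using mul_le_mul_of_nonneg_left (hP.even hs hst) hc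
  odd s t hs hst := by
    simpa only [mul_sub] using mul_le_mul_of_nonneg_left (hP.odd hs hst) hc

theorem even_nonneg (hP : SymmMono δ P) {t : ℝ} (ht : 0 ≤ t) : 0 ≤ P (δ + t) + P (δ - t) := by
  have := hP.even le_rfl ht
  have := hP.nonneg
  simp_all only [add_zero, sub_zero]
  linarith

theorem odd_nonneg (hP : SymmMono δ P) {t : ℝ} (ht : 0 ≤ t) : 0 ≤ P (δ + t) - P (δ - t) := by
  simpa using hP.odd le_rfl ht

theorem mul_add_const (hP : SymmMono δ P) (hδ : 0 ≤ δ) {b : ℝ} (hb : 0 ≤ b) :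
    SymmMono δ fun v => P v * (v + b) where
  nonneg := mul_nonneg hP.nonneg (by positivity)
  even s t hs hst := by
    have h1 := mul_le_mul_of_nonneg_left (hP.even hs hst) (add_nonneg hδ hb)
    have h2 := mul_le_mul hst (hP.odd hs hst) (hP.odd_nonneg hs) (hs.trans hst)
    linarith
  odd s t hs hst := by
    have h1 := mul_le_mul_of_nonneg_left (hP.odd hs hst) (add_nonneg hδ hb)
    have h2 := mul_le_mul hst (hP.even hs hst) (hP.even_nonneg hs) (hs.trans hst)
    linarith

theorem mul_prod_add (hP : SymmMono δ P) (hδ : 0 ≤ δ) (m : ℕ) {b : ℕ → ℝ} (hb : ∀ i, 0 ≤ b i) :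
    SymmMono δ fun v => P v * ∏ i ∈ Finset.range m, (v + b i) := by
  induction m with
  | zero => simpa using hP
  | succ m ih =>
    simp only [Finset.prod_range_succ, ← mul_assoc]
    exact ih.mul_add_const hδ (hb m)

theorem exists_le_symm (hP : SymmMono δ P) (hδ : 0 ≤ δ) :
    ∃ K, 0 ≤ K ∧ ∀ t, K * (t ^ 2 + (δ ^ 2 - 1 / 4)) ≤
      ((δ - t) ^ 2 - 1 / 4) * P (δ - t) + ((δ + t) ^ 2 - 1 / 4) * P (δ + t) := by
  suffices h : ∃ K, 0 ≤ K ∧ ∀ t, 0 ≤ t → K * (t ^ 2 + (δ ^ 2 - 1 / 4)) ≤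
      ((δ - t) ^ 2 - 1 / 4) * P (δ - t) + ((δ + t) ^ 2 - 1 / 4) * P (δ + t) by
    obtain ⟨K, hK, h⟩ := h
    refine ⟨K, hK, fun t => ?_⟩
    rcases le_total 0 t with ht | ht
    · exact h t ht
    · have := h (-t) (neg_nonneg.2 ht)
      rw [neg_sq, sub_neg_eq_add, ← sub_eq_add_neg] at this
      linarith
  have hodd : ∀ t, 0 ≤ t → 0 ≤ 2 * δ * t * (P (δ + t) - P (δ - t)) := fun t ht =>
    mul_nonneg (by positivity) (hP.odd_nonneg ht)
  rcases le_total (1 / 4) (δ ^ 2) with hc | hc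
  · refine ⟨0, le_rfl, fun t ht => ?_⟩
    have h1 : 0 ≤ (t ^ 2 + (δ ^ 2 - 1 / 4)) * (P (δ + t) + P (δ - t)) :=
      mul_nonneg (add_nonneg (sq_nonneg t) (sub_nonneg.2 hc)) (hP.even_nonneg ht)
    linarith [hodd t ht]
  · set r := √(1 / 4 - δ ^ 2)
    have hr : r ^ 2 = 1 / 4 - δ ^ 2 := Real.sq_sqrt (sub_nonneg.2 hc)
    have hr0 : 0 ≤ r := Real.sqrt_nonneg _
    refine ⟨P (δ + r) + P (δ - r), hP.even_nonneg hr0, fun t ht => ?_⟩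
    have h1 : 0 ≤ (t ^ 2 - r ^ 2) *
        ((P (δ + t) + P (δ - t)) - (P (δ + r) + P (δ - r))) := by
      rcases le_total r t with hrt | hrt
      · exact mul_nonneg (sub_nonneg.2 (by gcongr)) (sub_nonneg.2 (hP.even hr0 hrt))
      · exact mul_nonneg_of_nonpos_of_nonpos (sub_nonpos.2 (by gcongr))
          (sub_nonpos.2 (hP.even ht hrt))
    rw [hr] at h1
    linarith [hodd t ht]

end SymmMono

namespace movingAvg

theorem nonneg_of_symmMono {q : ℕ} {y : ℝ} {P : ℝ → ℝ} (hc : Continuous P)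
    (hP : SymmMono (1 / 2 - y) P) (hy : y ≤ 1 / 2) (hq : 1 / 4 ≤ (1 / 2 - y) ^ 2 + q / 12) :
    0 ≤ movingAvg q (fun x => ((1 / 2 - x) ^ 2 - 1 / 4) * P (1 / 2 - x)) y := by
  obtain ⟨K, hK, h⟩ := hP.exists_le_symm (sub_nonneg.2 hy)
  set F : ℝ → ℝ := fun x => ((1 / 2 - x) ^ 2 - 1 / 4) * P (1 / 2 - x) with hF
  have hFc : Continuous F := by fun_prop
  have hFc' : Continuous fun x => F (2 * y - x) := by fun_prop
  have h1 : ∀ x, K * ((x - y) ^ 2 + ((1 / 2 - y) ^ 2 - 1 / 4)) ≤ F x + F (2 * y - x) := by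
    intro x
    convert h (x - y) using 2
    · simp only [hF]
      ring_nf
    · simp only [hF]
      ring_nf
  have h2 := movingAvg.mono q (by fun_prop) (by fun_prop) h1 y
  rw [movingAvg.add q hFc hFc', comp_sub_left q F, const_mul, sq_sub_add,
    show 2 * y - y = y by ring] at h2
  have h3 : 0 ≤ K * ((y - y) ^ 2 + q / 12 + ((1 / 2 - y) ^ 2 - 1 / 4)) :=
    mul_nonneg hK (by rw [sub_self]; linarith)
  linarith

variable {q : ℕ} {y : ℝ}

theorem binomCoeff_le_two_mul_succ (hy : y ≤ 1 / 2)
    (hq : 1 / 4 ≤ (1 / 2 - y) ^ 2 + q / 12) (m : ℕ) :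
    movingAvg q (binomCoeff (m + 2)) y ≤ 2 * movingAvg q (binomCoeff (m + 3)) y := by
  have hδ := sub_nonneg.2 hy
  have hP : SymmMono (1 / 2 - y) fun v => 1 / ((m + 3).factorial : ℝ) *
      ((∏ i ∈ Finset.range m, (v + ((i : ℝ) + 3 / 2))) * (2 * (v + m / 2))) := by
    have := (((SymmMono.const zero_le_two).mul_prod_add hδ m (b := fun i => (i : ℝ) + 3 / 2)
      fun i => by positivity).mul_add_const hδ (b := m / 2) (by positivity)).const_mul
      (c := 1 / ((m + 3).factorial : ℝ)) (by positivity)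
    convert this using 3
    ring
  have h1 := nonneg_of_symmMono (by fun_prop) hP hy hq
  simp only [← binomCoeff.two_mul_succ_sub] at h1
  have h2 := movingAvg.add q (f := fun x => 2 * binomCoeff (m + 3) x)
    (g := fun x => -1 * binomCoeff (m + 2) x)
    ((binomCoeff.continuous _).const_mul _) ((binomCoeff.continuous _).const_mul _) y
  simp only [const_mul] at h2
  simp only [neg_one_mul, ← sub_eq_add_neg] at h2
  linarith

theorem binomCoeff_nonneg (hy : y ≤ 1 / 2)
    (hq : 1 / 4 ≤ (1 / 2 - y) ^ 2 + q / 12) (m : ℕ) :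
    0 ≤ movingAvg q (binomCoeff (m + 2)) y := by
  induction m with
  | zero =>
    have h1 : binomCoeff 2 = fun x => 1 / 2 * ((x - 1 / 2) ^ 2 + -1 / 4) := by
      ext x
      simp [binomCoeff, Finset.prod_range_succ]
      ring
    rw [zero_add, h1, const_mul, sq_sub_add]
    linarith
  | succ m ih =>
    have := binomCoeff_le_two_mul_succ hy hq m
    rw [show m + 1 + 2 = m + 3 by rfl]
    linarith

end movingAvg

theorem integral_rpow_one_sub {z : ℝ} (hz : z < 1) (hz0 : z ≠ 0) :
    ∫ s in (-1 / 2 : ℝ)..(1 / 2), (1 - z) ^ (1 / 2 + s) = z / -Real.log (1 - z) := by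
  have hpos : 0 < 1 - z := sub_pos.2 hz
  have hlog : Real.log (1 - z) ≠ 0 := Real.log_ne_zero_of_pos_of_ne_one hpos (by simpa using hz0)
  have hd : ∀ s : ℝ, HasDerivAt (fun s => (1 - z) ^ (1 / 2 + s) / Real.log (1 - z))
      ((1 - z) ^ (1 / 2 + s)) s := by
    intro s
    have := ((((hasDerivAt_id s).const_add (1 / 2)).const_rpow hpos)).div_const (Real.log (1 - z))
    simpa [hlog] using this
  rw [integral_eq_sub_of_hasDerivAt (fun s _ => hd s)]
  · norm_num
    field_simp
    ring
  · refine Continuous.intervalIntegrable ?_ _ _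
    exact continuous_const.rpow (by fun_prop) fun _ => Or.inl hpos.ne'

theorem h_succ_eq_integral (p : ℝ) (q : ℕ) {z : ℝ} (hz : z < 1) :
    h p (q + 1) z = ∫ s in (-1 / 2 : ℝ)..(1 / 2), h (p + 1 / 2 + s) q z := by
  rcases eq_or_ne z 0 with rfl | hz0
  · norm_num [h]
  have hpos : 0 < 1 - z := sub_pos.2 hz
  have h1 : ∀ s : ℝ, h (p + 1 / 2 + s) q z =
      h p q z * (1 - z) ^ (1 / 2 + s) := by
    intro s
    simp only [h, if_neg hz0, add_assoc, Real.rpow_add hpos p]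
    ring
  simp only [h1, intervalIntegral.integral_const_mul, integral_rpow_one_sub hz hz0]
  simp only [h, if_neg hz0, pow_succ]
  field_simp

theorem hasSum_h (p : ℝ) (q : ℕ) {z : ℝ} (hz : |z| < 1) :
    HasSum (fun n => movingAvg q (binomCoeff n) (p + q / 2) * z ^ n) (h p q z) := by
  induction q generalizing p with
  | zero =>
    have h1 : h p 0 z = (1 - z) ^ p := by
      by_cases hz0 : z = 0 <;> simp [h, hz0]
    simpa [movingAvg, h1] using binomCoeff.hasSum p hz
  | succ q ih =>
    rw [h_succ_eq_integral p q (abs_lt.1 hz).2]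
    set A : ℝ := |p + (q + 1 : ℕ) / 2| + 1 / 2 + q / 2
    have h1 := intervalIntegral.hasSum_integral_of_dominated_convergence
      (μ := volume) (a := -1 / 2) (b := 1 / 2)
      (F := fun n s => movingAvg q (binomCoeff n) (p + (q + 1 : ℕ) / 2 + s) * z ^ n)
      (f := fun s => h (p + 1 / 2 + s) q z)
      (fun n _ => binomCoeff n (-A) * |z| ^ n) ?_ ?_ ?_ ?_ ?_
    · simp only [intervalIntegral.integral_mul_const] at h1
      exact h1
    · intro n
      exact (((movingAvg.continuous q (binomCoeff.continuous n)).comp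
        (continuous_const.add continuous_id)).mul_const _).aestronglyMeasurable
    · refine fun n => .of_forall fun s hs => ?_
      rw [Set.uIoc_of_le (by norm_num)] at hs
      rw [norm_mul, norm_pow, Real.norm_eq_abs, Real.norm_eq_abs]
      gcongr
      refine (binomCoeff.abs_movingAvg_le q n _).trans ((le_abs_self _).trans
        (binomCoeff.abs_le ?_))
      rw [abs_neg, abs_of_nonneg (by positivity)]
      have h2 := abs_add_le (p + (q + 1 : ℕ) / 2) s
      have h3 : |s| ≤ 1 / 2 := abs_le.2 ⟨by linarith [hs.1], hs.2⟩
      simp only [A]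
      linarith
    · exact .of_forall fun s _ => (binomCoeff.hasSum (-A) (by rwa [abs_abs])).summable
    · exact intervalIntegrable_const
    · refine .of_forall fun s _ => ?_
      have h2 := ih (p + 1 / 2 + s)
      rwa [show p + 1 / 2 + s + (q : ℝ) / 2 = p + (q + 1 : ℕ) / 2 + s by push_cast; ring] at h2

theorem iteratedDeriv_h_div_factorial (p : ℝ) (q n : ℕ) :
    iteratedDeriv n (h p q) 0 / n.factorial = movingAvg q (binomCoeff n) (p + q / 2) := by
  have h1 : HasFPowerSeriesAt (h p q) (FormalMultilinearSeries.ofScalars ℝ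
      fun n => movingAvg q (binomCoeff n) (p + q / 2)) 0 := by
    rw [hasFPowerSeriesAt_iff]
    filter_upwards [Metric.ball_mem_nhds (0 : ℝ) one_pos] with z hz
    simpa [FormalMultilinearSeries.coeff_ofScalars, mul_comm] using
      hasSum_h p q (by simpa using hz)
  have h2 := h1.eq_formalMultilinearSeries h1.analyticAt.hasFPowerSeriesAt
  simpa [FormalMultilinearSeries.coeff_ofScalars] using (congrArg (fun s => s.coeff n) h2).symm

/-- Lemma 1 of the Appendix: positivity and growth of the Laurent coefficients
`a_k(p,q)`. -/
theorem laurent_coeff_pos_and_growth (p : ℝ) (q : ℕ) (hq : 1 ≤ q)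
    (hpq : (q = 1 ∧ p ≤ -1 / Real.sqrt 6) ∨ (q = 2 ∧ p ≤ (-3 - Real.sqrt 3) / 6) ∨
      (3 ≤ q ∧ p ≤ (1 - (q : ℝ)) / 2)) :
    ∀ k : ℤ, -(q : ℤ) + 2 ≤ k → 0 ≤ a k p q ∧ a k p q ≤ 2 * a (k + 1) p q := by
  have hy : p + q / 2 ≤ 1 / 2 ∧ 1 / 4 ≤ (1 / 2 - (p + q / 2)) ^ 2 + (q : ℝ) / 12 := by
    rcases hpq with ⟨rfl, hp⟩ | ⟨rfl, hp⟩ | ⟨hq3, hp⟩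
    · have h1 : 0 ≤ 1 / √6 := by positivity
      have h2 : 1 / √6 ≤ -p := by linarith [neg_div (√6) 1]
      have h3 : (1 / √6) ^ 2 = 1 / 6 := by norm_num [div_pow]
      have h4 : (1 / √6) ^ 2 ≤ (-p) ^ 2 := by gcongr
      push_cast
      constructor <;> nlinarith
    · have h1 : 0 ≤ √3 / 6 := by positivity
      have h2 : √3 / 6 ≤ -p - 1 / 2 := by linarith
      have h3 : (√3 / 6) ^ 2 = 1 / 12 := by norm_num [div_pow]
      have h4 : (√3 / 6) ^ 2 ≤ (-p - 1 / 2) ^ 2 := by gcongr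
      push_cast
      constructor <;> nlinarith
    · have h1 : (3 : ℝ) ≤ q := by exact_mod_cast hq3
      exact ⟨by linarith, by linarith [sq_nonneg (1 / 2 - (p + (q : ℝ) / 2))]⟩
  intro k hk
  obtain ⟨m, hm⟩ : ∃ m : ℕ, k + q = m + 2 := ⟨(k + q - 2).toNat, by omega⟩
  have h1 : (k + q).toNat = m + 2 := by omega
  have h2 : (k + 1 + q).toNat = m + 3 := by omega
  simp only [a, h1, h2, iteratedDeriv_h_div_factorial]
  exact ⟨movingAvg.binomCoeff_nonneg hy.1 hy.2 m, movingAvg.binomCoeff_le_two_mul_succ hy.1 hy.2 m⟩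
end

section
/- Integral recurrence for the Laurent coefficients a_k(p,q) (equation used in the inductive proof of Lemma 1). For every real p, every natural number q ≥ 1, and every natural number N, one has h_{p,q+1}^{(N)}(0) = ∫_0^1 h_{p+s,q}^{(N)}(0) ds; equivalently, a_k(p,q+1) = ∫_0^1 a_{k+1}(p+s,q) ds for every integer k ≥ -q-1. -/
open Set Filter Topology
open scoped ContDiff

/-- The partial derivative in the second variable of a jointly smooth function is its total
derivative in the direction `(0, 1)`. -/
lemma hasDerivAt_of_contDiffOn_uncurry {U : Set ℝ} (hU : IsOpen U) {f : ℝ → ℝ → ℝ}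
    (hf : ContDiffOn ℝ ∞ (fun x : ℝ × ℝ => f x.1 x.2) (univ ×ˢ U)) (s : ℝ) {z : ℝ} (hz : z ∈ U) :
    HasDerivAt (f s) (fderiv ℝ (fun x : ℝ × ℝ => f x.1 x.2) (s, z) (0, 1)) z := by
  have hd : HasFDerivAt (fun x : ℝ × ℝ => f x.1 x.2) _ (s, z) :=
    ((hf.contDiffAt ((isOpen_univ.prod hU).mem_nhds ⟨mem_univ s, hz⟩)).differentiableAt
      (by simp)).hasFDerivAt
  exact hd.comp_hasDerivAt z ((hasDerivAt_const z s).prodMk (hasDerivAt_id z))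

lemma contDiffOn_uncurry_deriv {U : Set ℝ} (hU : IsOpen U) {f : ℝ → ℝ → ℝ}
    (hf : ContDiffOn ℝ ∞ (fun x : ℝ × ℝ => f x.1 x.2) (univ ×ˢ U)) :
    ContDiffOn ℝ ∞ (fun x : ℝ × ℝ => deriv (f x.1) x.2) (univ ×ˢ U) := by
  refine ((hf.fderiv_of_isOpen (m := ∞) (isOpen_univ.prod hU) (by simp)).clm_apply
    (contDiffOn_const (c := ((0 : ℝ), (1 : ℝ))))).congr ?_
  rintro ⟨s, z⟩ ⟨-, hz⟩
  exact (hasDerivAt_of_contDiffOn_uncurry hU hf s hz).deriv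

lemma deriv_intervalIntegral_of_contDiffOn {U : Set ℝ} (hU : IsOpen U) {f : ℝ → ℝ → ℝ}
    (hf : ContDiffOn ℝ ∞ (fun x : ℝ × ℝ => f x.1 x.2) (univ ×ˢ U)) {a b : ℝ} {z : ℝ}
    (hz : z ∈ U) :
    deriv (fun w => ∫ s in a..b, f s w) z = ∫ s in a..b, deriv (f s) z := by
  have hf' := contDiffOn_uncurry_deriv hU hf
  have hslice {g : ℝ → ℝ → ℝ} (hg : ContDiffOn ℝ ∞ (fun x : ℝ × ℝ => g x.1 x.2) (univ ×ˢ U))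
      {w : ℝ} (hw : w ∈ U) : Continuous fun s => g s w :=
    hg.continuousOn.comp_continuous (Continuous.prodMk_left w) fun s => ⟨mem_univ s, hw⟩
  obtain ⟨r, hr, hrU⟩ := Metric.nhds_basis_closedBall.mem_iff.1 (hU.mem_nhds hz)
  obtain ⟨C, hC⟩ := (isCompact_uIcc.prod (isCompact_closedBall z r)).exists_bound_of_continuousOn
    (hf'.continuousOn.mono (prod_mono (subset_univ (uIcc a b)) hrU))
  refine (intervalIntegral.hasDerivAt_integral_of_dominated_loc_of_deriv_le
    (F := fun w s => f s w) (F' := fun w s => deriv (f s) w) (bound := fun _ => C)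
    (Metric.closedBall_mem_nhds z hr) ?_ ((hslice hf hz).intervalIntegrable a b)
    (hslice hf' hz).aestronglyMeasurable ?_ intervalIntegrable_const ?_).2.deriv
  · filter_upwards [hU.mem_nhds hz] with w hw
    exact (hslice hf hw).aestronglyMeasurable
  · exact .of_forall fun s hs w hw => hC (s, w) ⟨uIoc_subset_uIcc hs, hw⟩
  · exact .of_forall fun s _ w hw =>
      (hasDerivAt_of_contDiffOn_uncurry hU hf s (hrU hw)).differentiableAt.hasDerivAt

/-- Iterated differentiation under the integral sign for jointly smooth integrands. -/
lemma iteratedDeriv_intervalIntegral_of_contDiffOn {U : Set ℝ} (hU : IsOpen U) {a b : ℝ} (N : ℕ)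
    {f : ℝ → ℝ → ℝ} (hf : ContDiffOn ℝ ∞ (fun x : ℝ × ℝ => f x.1 x.2) (univ ×ˢ U)) {z : ℝ}
    (hz : z ∈ U) :
    iteratedDeriv N (fun w => ∫ s in a..b, f s w) z = ∫ s in a..b, iteratedDeriv N (f s) z := by
  induction N generalizing f with
  | zero => simp
  | succ n ih =>
    simp only [iteratedDeriv_succ']
    rw [← ih (contDiffOn_uncurry_deriv hU hf)]
    refine Filter.EventuallyEq.iteratedDeriv_eq n ?_
    filter_upwards [hU.mem_nhds hz] with w hw
    exact deriv_intervalIntegral_of_contDiffOn hU hf hw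

lemma integral_rpow_add {x : ℝ} (hx : 0 < x) (hx1 : x ≠ 1) (p : ℝ) :
    ∫ s in (0 : ℝ)..1, x ^ (p + s) = x ^ p * (x - 1) / Real.log x := by
  have hlog : Real.log x ≠ 0 := Real.log_ne_zero_of_pos_of_ne_one hx hx1
  have hderiv (s : ℝ) : HasDerivAt (fun s => x ^ (p + s) / Real.log x) (x ^ (p + s)) s := by
    have := (((hasDerivAt_id s).const_add p).const_rpow hx).div_const (Real.log x)
    exact this.congr_deriv (by simp [hlog])
  rw [intervalIntegral.integral_eq_sub_of_hasDerivAt (fun s _ => hderiv s)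
    (Continuous.intervalIntegrable (by fun_prop (disch := simp [hx.ne'])) 0 1),
    Real.rpow_add hx]
  simp only [Real.rpow_one, add_zero]
  ring

lemma h_add_one_eq_integral (p : ℝ) (q : ℕ) {z : ℝ} (hz : z < 1) :
    h p (q + 1) z = ∫ s in (0 : ℝ)..1, h (p + s) q z := by
  by_cases hz0 : z = 0
  · simp [h, hz0]
  · have hpos : 0 < 1 - z := by linarith
    have hne : 1 - z ≠ 1 := by simpa using hz0
    have hlog : Real.log (1 - z) ≠ 0 := Real.log_ne_zero_of_pos_of_ne_one hpos hne
    simp only [h, hz0, if_false, mul_div_assoc]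
    rw [intervalIntegral.integral_mul_const, integral_rpow_add hpos hne]
    generalize Real.log (1 - z) = L at hlog ⊢
    obtain ⟨y, rfl⟩ : ∃ y, L = -y := ⟨-L, by simp⟩
    have hy : y ≠ 0 := neg_ne_zero.1 hlog
    simp only [neg_neg]
    field_simp
    ring

lemma hasDerivAt_neg_log_one_sub : HasDerivAt (fun w : ℝ => -Real.log (1 - w)) 1 0 := by
  have := (((hasDerivAt_id (0 : ℝ)).const_sub 1).log (by simp)).neg
  exact this.congr_deriv (by simp)

lemma h_eq_rpow_mul_inv_dslope (p : ℝ) (q : ℕ) (z : ℝ) :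
    h p q z = (1 - z) ^ p * (dslope (fun w => -Real.log (1 - w)) 0 z)⁻¹ ^ q := by
  by_cases hz : z = 0
  · simp [h, hz, dslope_same, hasDerivAt_neg_log_one_sub.deriv]
  · rw [dslope_of_ne _ hz, slope_def_field]
    simp [h, hz, div_pow, mul_div_assoc]

lemma analyticAt_inv_dslope_neg_log :
    AnalyticAt ℝ (dslope (fun w : ℝ => -Real.log (1 - w)) 0)⁻¹ 0 := by
  have hlog : AnalyticAt ℝ (fun w : ℝ => -Real.log (1 - w)) 0 :=
    ((analyticAt_const.sub analyticAt_id).log (by simp)).neg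
  obtain ⟨P, hP⟩ := hlog
  refine AnalyticAt.inv ⟨_, hP.has_fpower_series_dslope_fslope⟩ ?_
  simp [dslope_same, hasDerivAt_neg_log_one_sub.deriv]

lemma iteratedDeriv_h_add_one (p : ℝ) (q N : ℕ) :
    iteratedDeriv N (h p (q + 1)) 0 = ∫ s in (0 : ℝ)..1, iteratedDeriv N (h (p + s) q) 0 := by
  set g : ℝ → ℝ := (dslope (fun w : ℝ => -Real.log (1 - w)) 0)⁻¹ with hg
  set U : Set ℝ := {z | AnalyticAt ℝ g z} ∩ Iio 1 with hUdef
  have hU : IsOpen U := (isOpen_analyticAt ℝ g).inter isOpen_Iio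
  have h0 : (0 : ℝ) ∈ U := ⟨analyticAt_inv_dslope_neg_log, mem_Iio.2 one_pos⟩
  have hsmooth : ContDiffOn ℝ ∞ (fun x : ℝ × ℝ => h (p + x.1) q x.2) (univ ×ˢ U) := by
    rintro ⟨s, z⟩ ⟨-, hz, hz1⟩
    simp only [h_eq_rpow_mul_inv_dslope]
    have hgz : ContDiffAt ℝ ∞ (fun x : ℝ × ℝ => g x.2) (s, z) :=
      (AnalyticAt.contDiffAt hz).comp (s, z) contDiffAt_snd
    have hpow : ContDiffAt ℝ ∞ (fun x : ℝ × ℝ => (1 - x.2) ^ (p + x.1)) (s, z) :=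
      ContDiffAt.rpow (contDiffAt_const.sub contDiffAt_snd) (contDiffAt_const.add contDiffAt_fst)
        (sub_pos.2 hz1).ne'
    exact (hpow.mul (hgz.pow q)).contDiffWithinAt
  rw [← iteratedDeriv_intervalIntegral_of_contDiffOn hU N (f := fun s => h (p + s) q) hsmooth h0]
  refine Filter.EventuallyEq.iteratedDeriv_eq N ?_
  filter_upwards [Iio_mem_nhds (one_pos : (0 : ℝ) < 1)] with z hz
  exact h_add_one_eq_integral p q hz

/-- Integral recurrence for the Laurent coefficients `a_k(p,q)`, used in the inductive
proof of Lemma 1 of the Appendix. -/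
theorem laurent_coeff_integral_recurrence (p : ℝ) (q : ℕ) (hq : 1 ≤ q) :
    (∀ N : ℕ, iteratedDeriv N (h p (q + 1)) 0 = ∫ s in (0:ℝ)..1, iteratedDeriv N (h (p + s) q) 0) ∧
    (∀ k : ℤ, -(q : ℤ) - 1 ≤ k → a k p (q + 1) = ∫ s in (0:ℝ)..1, a (k + 1) (p + s) q) := by
  refine ⟨iteratedDeriv_h_add_one p q, fun k _ => ?_⟩
  have hk : k + ((q + 1 : ℕ) : ℤ) = k + 1 + q := by push_cast; ring
  simp only [a, hk]
  rw [intervalIntegral.integral_div, iteratedDeriv_h_add_one]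
end

section
/- Positivity of the Taylor coefficients of -(1-z)^{-1/2}/log(1-z) (proved in Section 4.2). Let g : (-1,1) → ℝ be defined by g(z) = -z·(1-z)^{-1/2}/log(1-z) for z ≠ 0 and g(0) = 1; g is real-analytic at 0. Then for every natural number m, the m-th iterated derivative g^{(m)}(0) is nonnegative. Equivalently, for every natural number m, ∫_0^1 ∏_{i=0}^{m-1} (1/2 - s + i) ds ≥ 0. -/
/-- The function `z ↦ -z (1-z)^{-1/2} / log(1-z)`, extended by its limiting value `1`
at `z = 0`; it is real-analytic at `0`. -/
noncomputable def gHalf : ℝ → ℝ := fun z =>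
  if z = 0 then 1 else -z * (1 - z) ^ (-(1:ℝ) / 2) / Real.log (1 - z)

lemma hasDerivAt_intervalIntegral_one_sub_rpow {p : ℝ → ℝ} (hp : Continuous p) (a : ℝ) {z : ℝ}
    (hz : z < 1) :
    HasDerivAt (fun z : ℝ => ∫ s in (0 : ℝ)..1, p s * (1 - z) ^ (s - a))
      (∫ s in (0 : ℝ)..1, p s * (a - s) * (1 - z) ^ (s - (a + 1))) z := by
  have hε : 0 < (1 - z) / 2 := by linarith
  have hlt : ∀ x ∈ Metric.closedBall z ((1 - z) / 2), 0 < 1 - x := by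
    intro x hx
    rw [Metric.mem_closedBall, Real.dist_eq] at hx
    linarith [le_abs_self (x - z)]
  have hcont : ∀ (q : ℝ → ℝ) (_ : Continuous q) (b x : ℝ) (_ : 0 < 1 - x),
      Continuous fun s => q s * (1 - x) ^ (s - b) := fun q hq b x hx =>
    hq.mul (continuous_const.rpow (by fun_prop) fun _ => Or.inl hx.ne')
  have hjoint : ContinuousOn
      (fun y : ℝ × ℝ => p y.2 * (a - y.2) * (1 - y.1) ^ (y.2 - (a + 1)))
      (Metric.closedBall z ((1 - z) / 2) ×ˢ Set.Icc 0 1) := by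
    refine ContinuousOn.mul (by fun_prop) (ContinuousOn.rpow (by fun_prop) (by fun_prop) ?_)
    exact fun y hy => Or.inl (hlt y.1 hy.1).ne'
  obtain ⟨C, hC⟩ := ((isCompact_closedBall z ((1 - z) / 2)).prod
    isCompact_Icc).exists_bound_of_continuousOn hjoint
  refine (intervalIntegral.hasDerivAt_integral_of_dominated_loc_of_deriv_le
    (μ := MeasureTheory.volume)
    (F := fun z s => p s * (1 - z) ^ (s - a))
    (F' := fun z s => p s * (a - s) * (1 - z) ^ (s - (a + 1))) (bound := fun _ => C)
    (Metric.closedBall_mem_nhds z hε) ?_ ?_ ?_ ?_ ?_ ?_).2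
  · filter_upwards [Metric.closedBall_mem_nhds z hε] with x hx
    exact (hcont p hp a x (hlt x hx)).aestronglyMeasurable
  · exact (hcont p hp a z (by linarith)).intervalIntegrable _ _
  · exact (hcont _ (hp.mul (by fun_prop)) (a + 1) z (by linarith)).aestronglyMeasurable
  · refine Filter.Eventually.of_forall fun s hs x hx => hC (x, s) ⟨hx, ?_⟩
    rw [Set.uIoc_of_le zero_le_one] at hs
    exact Set.Ioc_subset_Icc_self hs
  · exact intervalIntegrable_const
  · refine Filter.Eventually.of_forall fun s _ x hx => ?_
    have h := (((hasDerivAt_id x).const_sub 1).rpow_const (p := s - a)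
      (Or.inl (hlt x hx).ne')).const_mul (p s)
    refine h.congr_deriv ?_
    rw [show s - (a + 1) = s - a - 1 by ring]
    simp only [id]
    ring

lemma gHalf_eq_intervalIntegral {z : ℝ} (hz : z < 1) :
    gHalf z = ∫ s in (0 : ℝ)..1, (1 - z) ^ (s - 1 / 2) := by
  have hpos : 0 < 1 - z := by linarith
  by_cases h0 : z = 0
  · simp [gHalf, h0]
  have hlog : Real.log (1 - z) ≠ 0 :=
    Real.log_ne_zero_of_pos_of_ne_one hpos fun h => h0 (by linarith)
  have hderiv : ∀ s ∈ Set.uIcc (0 : ℝ) 1,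
      HasDerivAt (fun s : ℝ => (1 - z) ^ (s - 1 / 2) / Real.log (1 - z))
        ((1 - z) ^ (s - 1 / 2)) s := by
    intro s _
    have h := (((hasDerivAt_id s).sub_const (1 / 2)).const_rpow hpos).div_const (Real.log (1 - z))
    refine h.congr_deriv ?_
    simp only [id]
    field_simp
  have hc : Continuous fun s : ℝ => (1 - z) ^ (s - 1 / 2) :=
    continuous_const.rpow (by fun_prop) fun _ => Or.inl hpos.ne'
  rw [intervalIntegral.integral_eq_sub_of_hasDerivAt hderiv (hc.intervalIntegrable _ _), gHalf,
    if_neg h0, ← sub_div, show (1 : ℝ) - 1 / 2 = -1 / 2 + 1 by norm_num,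
    show (0 : ℝ) - 1 / 2 = -1 / 2 by norm_num, Real.rpow_add_one hpos.ne']
  ring

lemma iteratedDeriv_gHalf_eq_intervalIntegral (m : ℕ) {z : ℝ} (hz : z < 1) :
    iteratedDeriv m gHalf z = ∫ s in (0 : ℝ)..1,
      (∏ i ∈ Finset.range m, (1 / 2 - s + (i : ℝ))) * (1 - z) ^ (s - (1 / 2 + m)) := by
  induction m generalizing z with
  | zero => simpa using gHalf_eq_intervalIntegral hz
  | succ m ih =>
    have heq : iteratedDeriv m gHalf =ᶠ[nhds z] fun z => ∫ s in (0 : ℝ)..1,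
        (∏ i ∈ Finset.range m, (1 / 2 - s + (i : ℝ))) * (1 - z) ^ (s - (1 / 2 + m)) := by
      filter_upwards [Iio_mem_nhds hz] with x hx using ih hx
    rw [iteratedDeriv_succ, heq.deriv_eq,
      (hasDerivAt_intervalIntegral_one_sub_rpow (by fun_prop) _ hz).deriv]
    refine intervalIntegral.integral_congr fun s _ => ?_
    simp only [Finset.prod_range_succ, Nat.cast_succ]
    rw [← add_assoc, show 1 / 2 + (m : ℝ) - s = 1 / 2 - s + m by ring]

lemma prod_add_prod_neg_nonneg (m : ℕ) {u : ℝ} (h0 : 0 ≤ u) (h1 : u ≤ 1) :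
    0 ≤ ∏ i ∈ Finset.range m, (u + i) + ∏ i ∈ Finset.range m, (-u + i) := by
  cases m with
  | zero => simp
  | succ m =>
    have hle : ∏ i ∈ Finset.range m, (-u + ((i + 1 : ℕ) : ℝ)) ≤
        ∏ i ∈ Finset.range m, (u + ((i + 1 : ℕ) : ℝ)) := by
      refine Finset.prod_le_prod (fun i _ => ?_) fun i _ => by linarith
      push_cast
      linarith [(Nat.cast_nonneg i : (0 : ℝ) ≤ i)]
    rw [Finset.prod_range_succ', Finset.prod_range_succ']
    simp only [Nat.cast_zero, add_zero]
    linarith [mul_le_mul_of_nonneg_left hle h0]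

lemma integral_risingFactorial_nonneg (m : ℕ) :
    0 ≤ ∫ s in (0 : ℝ)..1, ∏ i ∈ Finset.range m, (1 / 2 - s + (i : ℝ)) := by
  set f : ℝ → ℝ := fun u => ∏ i ∈ Finset.range m, (u + (i : ℝ)) with hf
  have hc : Continuous f := by fun_prop
  have hcn : Continuous fun u => f (-u) := hc.comp continuous_neg
  have hshift : ∫ s in (0 : ℝ)..1, ∏ i ∈ Finset.range m, (1 / 2 - s + (i : ℝ)) =
      ∫ u in (-(1 / 2) : ℝ)..(1 / 2), f u := by
    have h := intervalIntegral.integral_comp_sub_left (a := 0) (b := 1) f (1 / 2)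
    rwa [show (1 / 2 : ℝ) - 1 = -(1 / 2) by norm_num, sub_zero] at h
  have hneg : ∫ u in (-(1 / 2) : ℝ)..0, f u = ∫ u in (0 : ℝ)..(1 / 2), f (-u) := by
    rw [intervalIntegral.integral_comp_neg, neg_zero]
  rw [hshift, ← intervalIntegral.integral_add_adjacent_intervals
    (hc.intervalIntegrable _ 0) (hc.intervalIntegrable _ _), hneg,
    ← intervalIntegral.integral_add (hcn.intervalIntegrable _ _) (hc.intervalIntegrable _ _)]
  refine intervalIntegral.integral_nonneg (by norm_num) fun u hu => ?_
  rw [add_comm]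
  exact prod_add_prod_neg_nonneg m hu.1 (by linarith [hu.2])

/-- Positivity of the Taylor coefficients of `-(1-z)^{-1/2}/log(1-z)` (Section 4.2):
every iterated derivative of `gHalf` at `0` is nonnegative; equivalently, the integrals
`∫_0^1 (1/2 - s)_(m) ds` of the rising factorial are nonnegative. -/
theorem gHalf_taylor_coeff_nonneg :
    ∀ m : ℕ, 0 ≤ iteratedDeriv m gHalf 0 ∧
      0 ≤ ∫ s in (0:ℝ)..1, ∏ i ∈ Finset.range m, (1 / 2 - s + (i : ℝ)) := by
  intro m
  refine ⟨?_, integral_risingFactorial_nonneg m⟩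
  rw [iteratedDeriv_gHalf_eq_intervalIntegral m zero_lt_one]
  simpa using integral_risingFactorial_nonneg m
end
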